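/- arXiv:1701.06632 — 2 statements merged into one kernel-verified Lean document; each statement's English description precedes it below -/
import Mathlib

section
/- Let s ≥ 2 be a rational number, let q be its denominator (when written in lowest terms), and let t = ⌊log₂ s⌋. Let m ≥ 1 be an integer. For any finite set system S, if f_S(m) ≤ s·m − 3q·s²·log₂ s, then for all integers n ≥ m one has f_S(n) ≤ 2^{t+2} · m^{2t+2} · n^{t+1−(2^{t+1}−t−2)/(s−1)}. -/
/-- The shatter function of a set system `S` on the finite ground set `X`:
`f_S(m) = max { |{e ∩ Y : e ∈ S}| : Y ⊆ X, |Y| = m }`. -/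
def shatter {X : Type*} [DecidableEq X] [Fintype X]
    (S : Finset (Finset X)) (m : ℕ) : ℕ :=
  (Finset.univ.powersetCard m).sup (fun Y => (S.image (· ∩ Y)).card)

namespace RSB

/-! ### Down-compression -/

def phi {X : Type*} [DecidableEq X] (A : Finset (Finset X)) (a : X) (e : Finset X) : Finset X :=
  if e.erase a ∈ A then e else e.erase a

lemma phi_injOn {X : Type*} [DecidableEq X] (A : Finset (Finset X)) (a : X) :
    Set.InjOn (phi A a) (A : Set (Finset X)) := by
  intro e he f hf h
  have he' : e ∈ A := he
  have hf' : f ∈ A := hf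
  unfold phi at h
  have key : ∀ g ∈ A, g.erase a ∉ A → insert a (g.erase a) = g := by
    intro g hg hga
    apply Finset.insert_erase
    by_contra hn
    rw [Finset.erase_eq_of_notMem hn] at hga
    exact hga hg
  split_ifs at h with h1 h2 h2
  · exact h
  · rw [h] at he'; exact absurd he' h2
  · rw [← h] at hf'; exact absurd hf' h1
  · rw [← key e he' h1, ← key f hf' h2, h]

lemma phi_trace {X : Type*} [DecidableEq X] (A : Finset (Finset X)) (a : X) (Y : Finset X) :
    ((A.image (phi A a)).image (· ∩ Y)).card ≤ (A.image (· ∩ Y)).card := by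
  by_cases ha : a ∈ Y
  · set B := A.image (· ∩ Y) with hB
    have hsub : (A.image (phi A a)).image (· ∩ Y) ⊆ B.image (phi B a) := by
      intro g hg
      simp only [Finset.mem_image] at hg
      obtain ⟨_, ⟨e, he, rfl⟩, rfl⟩ := hg
      have heB : e ∩ Y ∈ B := Finset.mem_image_of_mem _ he
      have hE : (e.erase a) ∩ Y = (e ∩ Y).erase a := by
        ext x; simp only [Finset.mem_inter, Finset.mem_erase]; tauto
      by_cases h1 : e.erase a ∈ A
      · have h2 : (e ∩ Y).erase a ∈ B := by
          rw [← hE]; exact Finset.mem_image_of_mem _ h1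
        refine Finset.mem_image.2 ⟨e ∩ Y, heB, ?_⟩
        simp [phi, h1, h2]
      · have hp : phi A a e = e.erase a := by simp [phi, h1]
        rw [hp, hE]
        by_cases h2 : (e ∩ Y).erase a ∈ B
        · refine Finset.mem_image.2 ⟨(e ∩ Y).erase a, h2, ?_⟩
          simp [phi, h2]
        · refine Finset.mem_image.2 ⟨e ∩ Y, heB, ?_⟩
          simp [phi, h2]
    exact (Finset.card_le_card hsub).trans Finset.card_image_le
  · apply Finset.card_le_card
    intro g hg
    simp only [Finset.mem_image] at hg
    obtain ⟨_, ⟨e, he, rfl⟩, rfl⟩ := hg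
    refine Finset.mem_image.2 ⟨e, he, ?_⟩
    unfold phi
    split_ifs
    · rfl
    · ext x; simp only [Finset.mem_inter, Finset.mem_erase]
      constructor
      · rintro ⟨h1, h2⟩; exact ⟨⟨fun h => ha (h ▸ h2), h1⟩, h2⟩
      · tauto

lemma exists_down {X : Type*} [DecidableEq X] (S : Finset (Finset X)) (Z : Finset X)
    (hZ : ∀ e ∈ S, e ⊆ Z) :
    ∃ D : Finset (Finset X), D.card = S.card ∧ (∀ e ∈ D, e ⊆ Z) ∧
      (∀ e ∈ D, ∀ f, f ⊆ e → f ∈ D) ∧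
      ∀ Y : Finset X, (D.image (· ∩ Y)).card ≤ (S.image (· ∩ Y)).card := by
  suffices H : ∀ N : ℕ, ∀ A : Finset (Finset X), ∑ e ∈ A, e.card = N → A.card = S.card →
      (∀ e ∈ A, e ⊆ Z) →
      (∀ Y : Finset X, (A.image (· ∩ Y)).card ≤ (S.image (· ∩ Y)).card) →
      ∃ D : Finset (Finset X), D.card = S.card ∧ (∀ e ∈ D, e ⊆ Z) ∧
      (∀ e ∈ D, ∀ f, f ⊆ e → f ∈ D) ∧
      ∀ Y : Finset X, (D.image (· ∩ Y)).card ≤ (S.image (· ∩ Y)).card from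
    H _ S rfl rfl hZ (fun _ => le_rfl)
  intro N
  induction N using Nat.strong_induction_on with
  | _ N ih =>
    intro A hN hc hA hT
    by_cases hd : ∃ e ∈ A, ∃ a ∈ e, e.erase a ∉ A
    · obtain ⟨e, he, a, hae, hea⟩ := hd
      have hle : ∀ f : Finset X, phi A a f ⊆ f := by
        intro f; unfold phi; split_ifs
        · exact subset_rfl
        · exact Finset.erase_subset _ _
      refine ih (∑ e ∈ A.image (phi A a), e.card) ?_ (A.image (phi A a)) rfl ?_ ?_ ?_
      · rw [Finset.sum_image (phi_injOn A a), ← hN]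
        apply Finset.sum_lt_sum
        · intro f _; exact Finset.card_le_card (hle f)
        · refine ⟨e, he, ?_⟩
          simp only [phi, hea, if_false]
          exact Finset.card_erase_lt_of_mem hae
      · rw [Finset.card_image_of_injOn (phi_injOn A a), hc]
      · intro f hf
        obtain ⟨g, hg, rfl⟩ := Finset.mem_image.1 hf
        exact (hle g).trans (hA g hg)
      · intro Y
        exact (phi_trace A a Y).trans (hT Y)
    · push Not at hd
      refine ⟨A, hc, hA, ?_, hT⟩
      have : ∀ k : ℕ, ∀ e ∈ A, ∀ f, f ⊆ e → (e \ f).card = k → f ∈ A := by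
        intro k
        induction k with
        | zero =>
          intro e he f hf h0
          have : e ⊆ f := by
            rw [Finset.card_eq_zero] at h0
            exact Finset.sdiff_eq_empty_iff_subset.1 h0
          rwa [Finset.Subset.antisymm hf this]
        | succ k ihk =>
          intro e he f hf h0
          have hne : (e \ f).Nonempty := by
            rw [← Finset.card_pos]; omega
          obtain ⟨a, ha⟩ := hne
          have ha' := Finset.mem_sdiff.1 ha
          refine ihk (e.erase a) (hd e he a ha'.1) f ?_ ?_
          · exact Finset.subset_erase.2 ⟨hf, ha'.2⟩
          · rw [Finset.erase_sdiff_comm, Finset.card_erase_of_mem ha, h0]; rfl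
      intro e he f hf
      exact this _ e he f hf rfl

/-! ### Closure -/

def cnt {X : Type*} [DecidableEq X] (D : Finset (Finset X)) (Y : Finset X) : ℕ :=
  (D.filter (fun e => e ⊆ Y)).card

lemma cnt_mono {X : Type*} [DecidableEq X] (D : Finset (Finset X)) {Y Y' : Finset X}
    (h : Y ⊆ Y') : cnt D Y ≤ cnt D Y' := by
  apply Finset.card_le_card
  intro e he
  simp only [Finset.mem_filter] at he ⊢
  exact ⟨he.1, he.2.trans h⟩

lemma closure_exists {X : Type*} [DecidableEq X] [Fintype X] (D : Finset (Finset X))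
    (m M τ : ℕ) (s : ℝ) (hs : 0 < s)
    (hM : ∀ Y : Finset X, Y.card ≤ m → cnt D Y ≤ M)
    (hMs : (M : ℝ) + 2 * τ * s ≤ s * m) (R : Finset X) (hR : R.card ≤ τ) :
    ∃ Y : Finset X, R ⊆ Y ∧ Y.card ≤ m ∧
      ∀ U : Finset X, Disjoint U Y → U.card ≤ τ →
        (cnt D Y : ℝ) + s * U.card ≤ cnt D (Y ∪ U) → U = ∅ := by
  have h2 : 2 * τ ≤ m := by
    have : (2 * τ : ℝ) * s ≤ m * s := by
      have : (0:ℝ) ≤ M := Nat.cast_nonneg _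
      linarith
    have := le_of_mul_le_mul_right this hs
    exact_mod_cast this
  let C : Finset (Finset X) := Finset.univ.filter (fun Y => R ⊆ Y ∧ Y.card ≤ m ∧
    s * ((Y.card : ℝ) - R.card) ≤ cnt D Y)
  have hC : C.Nonempty := ⟨R, by simp [C]; omega⟩
  obtain ⟨Y, hY, hmax⟩ := C.exists_max_image (fun Y => Y.card) hC
  simp only [C, Finset.mem_filter, Finset.mem_univ, true_and] at hY hmax
  refine ⟨Y, hY.1, hY.2.1, ?_⟩
  intro U hdis hU hgain
  by_contra hne
  have hUpos : 0 < U.card := Finset.card_pos.2 (Finset.nonempty_iff_ne_empty.2 hne)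
  have hcard : (Y ∪ U).card = Y.card + U.card := Finset.card_union_of_disjoint hdis.symm
  have hle : (Y ∪ U).card ≤ m := by
    by_contra hlt
    have h3 : m < Y.card + τ := by omega
    have h4 : (cnt D Y : ℝ) ≤ M := by exact_mod_cast hM Y hY.2.1
    have h5 : (m : ℝ) < Y.card + τ := by exact_mod_cast h3
    have h6 : (R.card : ℝ) ≤ τ := by exact_mod_cast hR
    have h7 := hY.2.2
    have h8 : s * ((m : ℝ) - 2 * τ) < s * ((Y.card : ℝ) - R.card) := by
      apply mul_lt_mul_of_pos_left _ hs; linarith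
    nlinarith
  have := hmax (Y ∪ U) ⟨hY.1.trans Finset.subset_union_left, hle, by
    rw [hcard]; push_cast
    nlinarith [hY.2.2]⟩
  omega

/-! ### Gains -/

def bad {X : Type*} [DecidableEq X] (D : Finset (Finset X)) (Y W : Finset X) : ℕ :=
  (D.filter (fun G => G ⊆ W ∧ ¬ G ⊆ Y)).card

lemma bad_step {X : Type*} [DecidableEq X] (D : Finset (Finset X))
    (hD : ∀ e ∈ D, ∀ f, f ⊆ e → f ∈ D) (Y W P : Finset X) (v : X) (hv : v ∉ W) (hP : P ⊆ W)
    (hvP : insert v P ∈ D) :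
    bad D Y W + (P.powerset.filter (fun Q => ¬ insert v Q ⊆ Y)).card ≤ bad D Y (insert v W) := by
  have hinj : Set.InjOn (fun Q : Finset X => insert v Q)
      (P.powerset.filter (fun Q => ¬ insert v Q ⊆ Y) : Finset (Finset X)) := by
    intro A hA B hB h
    have hA' : v ∉ A := fun h' => hv (hP (Finset.mem_powerset.1 (Finset.mem_filter.1 hA).1 h'))
    have hB' : v ∉ B := fun h' => hv (hP (Finset.mem_powerset.1 (Finset.mem_filter.1 hB).1 h'))
    have h' : insert v A = insert v B := h
    rw [← Finset.erase_insert hA', h', Finset.erase_insert hB']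
  rw [bad, bad, ← Finset.card_image_of_injOn hinj, ← Finset.card_union_of_disjoint]
  · apply Finset.card_le_card
    intro G hG
    rcases Finset.mem_union.1 hG with h | h
    · simp only [Finset.mem_filter] at h ⊢
      exact ⟨h.1, h.2.1.trans (Finset.subset_insert _ _), h.2.2⟩
    · obtain ⟨Q, hQ, rfl⟩ := Finset.mem_image.1 h
      simp only [Finset.mem_filter, Finset.mem_powerset] at hQ ⊢
      exact ⟨hD _ hvP _ (Finset.insert_subset_insert _ hQ.1),
        Finset.insert_subset_insert _ (hQ.1.trans hP), hQ.2⟩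
  · rw [Finset.disjoint_left]
    intro G hG hG'
    obtain ⟨Q, hQ, rfl⟩ := Finset.mem_image.1 hG'
    simp only [Finset.mem_filter] at hG
    exact hv (hG.2.1 (Finset.mem_insert_self _ _))

lemma bad_mono {X : Type*} [DecidableEq X] (D : Finset (Finset X)) (Y W : Finset X) (v : X) :
    bad D Y W ≤ bad D Y (insert v W) := by
  apply Finset.card_le_card
  intro G h
  simp only [Finset.mem_filter] at h ⊢
  exact ⟨h.1, h.2.1.trans (Finset.subset_insert _ _), h.2.2⟩

lemma bad_out {X : Type*} [DecidableEq X] (D : Finset (Finset X))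
    (hD : ∀ e ∈ D, ∀ f, f ⊆ e → f ∈ D) (Y W P : Finset X) (v : X) (hv : v ∉ W) (hP : P ⊆ W)
    (hvP : insert v P ∈ D) (hvY : v ∉ Y) :
    bad D Y W + 2 ^ P.card ≤ bad D Y (insert v W) := by
  have := bad_step D hD Y W P v hv hP hvP
  rwa [Finset.filter_true_of_mem, Finset.card_powerset] at this
  intro Q _ h
  exact hvY (h (Finset.mem_insert_self _ _))

lemma bad_in {X : Type*} [DecidableEq X] (D : Finset (Finset X))
    (hD : ∀ e ∈ D, ∀ f, f ⊆ e → f ∈ D) (Y W P : Finset X) (v : X) (hv : v ∉ W) (hP : P ⊆ W)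
    (hvP : insert v P ∈ D) (hvY : v ∈ Y) :
    bad D Y W + 2 ^ P.card ≤ bad D Y (insert v W) + 2 ^ (P ∩ Y).card := by
  have := bad_step D hD Y W P v hv hP hvP
  have h2 := Finset.card_filter_add_card_filter_not (s := P.powerset) (fun Q => ¬ insert v Q ⊆ Y)
  have h3 : (P.powerset.filter (fun Q => ¬ ¬ insert v Q ⊆ Y)) = (P ∩ Y).powerset := by
    ext Q
    simp only [Finset.mem_filter, Finset.mem_powerset, not_not, Finset.insert_subset_iff,
      Finset.subset_inter_iff, hvY, true_and]
  rw [h3, Finset.card_powerset, Finset.card_powerset] at h2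
  omega

lemma pow_conc (j y : ℕ) (h : y ≤ j) : j * (2 ^ y - 1 : ℝ) ≤ y * (2 ^ j - 1) := by
  induction j with
  | zero => simp at h; subst h; simp
  | succ j ih =>
    rcases Nat.lt_or_ge j y with h1 | h1
    · have : y = j + 1 := by omega
      subst this; exact le_rfl
    · have ih' := ih h1
      have hy : (1:ℝ) ≤ 2 ^ y := one_le_pow₀ (by norm_num)
      rcases Nat.eq_zero_or_pos j with h0 | h0
      · subst h0; simp at h1; subst h1; simp
      · have hj : (1:ℝ) ≤ j := by exact_mod_cast h0
        have hyy : (0:ℝ) ≤ y := Nat.cast_nonneg _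
        push_cast
        rw [pow_succ]
        nlinarith

/-- Number of entries of a list outside `Y`. -/
def cn {X : Type*} [DecidableEq X] (Y : Finset X) (L : List X) : ℕ :=
  L.countP (fun x => x ∉ Y)

lemma cn_le {X : Type*} [DecidableEq X] (Y : Finset X) (L : List X) : cn Y L ≤ L.length :=
  List.countP_le_length

lemma cn_cons {X : Type*} [DecidableEq X] (Y : Finset X) (L : List X) (v : X) :
    cn Y (v :: L) = cn Y L + if v ∉ Y then 1 else 0 := by
  simp [cn, List.countP_cons]

lemma cn_append {X : Type*} [DecidableEq X] (Y : Finset X) (L L' : List X) :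
    cn Y (L ++ L') = cn Y L + cn Y L' := by
  simp [cn, List.countP_append]

lemma cn_inter {X : Type*} [DecidableEq X] (Y : Finset X) (L : List X) (h : L.Nodup) :
    (L.toFinset ∩ Y).card + cn Y L = L.length := by
  induction L with
  | nil => simp [cn]
  | cons v L ih =>
    rw [List.nodup_cons] at h
    have := ih h.2
    rw [cn_cons, List.toFinset_cons, List.length_cons]
    by_cases hv : v ∈ Y
    · rw [Finset.insert_inter_of_mem hv, Finset.card_insert_of_notMem]
      · simp [hv]; omega
      · simp [h.1]
    · rw [Finset.insert_inter_of_notMem hv]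
      simp [hv]; omega

lemma bad_in1 {X : Type*} [DecidableEq X] (D : Finset (Finset X))
    (hD : ∀ e ∈ D, ∀ f, f ⊆ e → f ∈ D) (Y W : Finset X) (P : List X) (v : X) (j : ℕ) (hj : 1 ≤ j)
    (hv : v ∉ W) (hnd : P.Nodup) (hlen : P.length = j) (hP : P.toFinset ⊆ W)
    (hvP : insert v P.toFinset ∈ D) (hvY : v ∈ Y) :
    (bad D Y W : ℝ) + (2 ^ j - 1) / j * cn Y P ≤ bad D Y (insert v W) := by
  have h := bad_in D hD Y W _ v hv hP hvP hvY
  have h1 := cn_inter Y P hnd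
  rw [List.toFinset_card_of_nodup hnd, hlen] at h
  set y := (P.toFinset ∩ Y).card
  have h2 := pow_conc j y (by omega)
  have h3 : (cn Y P : ℝ) = j - y := by
    have : (y : ℝ) + cn Y P = j := by exact_mod_cast h1.trans hlen
    linarith
  have h4 : (bad D Y W : ℝ) + 2 ^ j ≤ bad D Y (insert v W) + 2 ^ y := by exact_mod_cast h
  have hj' : (0:ℝ) < j := by exact_mod_cast hj
  have h5 : ((2:ℝ) ^ j - 1) / j * cn Y P ≤ 2 ^ j - 2 ^ y := by
    rw [h3, div_mul_eq_mul_div, div_le_iff₀ hj']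
    nlinarith
  linarith

lemma bad_in2 {X : Type*} [DecidableEq X] (D : Finset (Finset X))
    (hD : ∀ e ∈ D, ∀ f, f ⊆ e → f ∈ D) (Y W : Finset X) (P : List X) (v : X) (j : ℕ)
    (hv : v ∉ W) (hnd : P.Nodup) (hlen : P.length = j) (hP : P.toFinset ⊆ W)
    (hvP : insert v P.toFinset ∈ D) (hvY : v ∈ Y) (hc : 1 ≤ cn Y P) :
    (bad D Y W : ℝ) + 2 ^ (j - 1) ≤ bad D Y (insert v W) := by
  have h := bad_in D hD Y W _ v hv hP hvP hvY
  have h1 := cn_inter Y P hnd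
  rw [List.toFinset_card_of_nodup hnd, hlen] at h
  set y := (P.toFinset ∩ Y).card
  have hy : y ≤ j - 1 := by omega
  have h2 : 2 ^ y ≤ 2 ^ (j - 1) := Nat.pow_le_pow_right (by norm_num) hy
  have h3 : 2 ^ j = 2 * 2 ^ (j - 1) := by
    rw [← pow_succ']; congr 1; omega
  have : bad D Y W + 2 ^ (j - 1) ≤ bad D Y (insert v W) := by omega
  exact_mod_cast this

/-! ### Runs -/

def VY {X : Type*} [DecidableEq X] (D : Finset (Finset X)) (Y : Finset X) :
    List Bool → List X → Finset X → List X → Prop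
  | [], _, _, [] => True
  | (c :: σ), P, W, (v :: vs) => v ∉ W ∧ insert v P.toFinset ∈ D ∧ (c = false → v ∈ Y) ∧
      VY D Y σ (if c then P.tail ++ [v] else P) (insert v W) vs
  | _, _, _, _ => False

lemma VY_cons {X : Type*} [DecidableEq X] {D : Finset (Finset X)} {Y : Finset X} {c : Bool}
    {σ : List Bool} {P : List X} {W : Finset X} {v : List X} (h : VY D Y (c :: σ) P W v) :
    ∃ w vs, v = w :: vs ∧ w ∉ W ∧ insert w P.toFinset ∈ D ∧ (c = false → w ∈ Y) ∧
      VY D Y σ (if c then P.tail ++ [w] else P) (insert w W) vs := by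
  cases v with
  | nil => exact absurd h (by simp [VY])
  | cons w vs => exact ⟨w, vs, rfl, h⟩

lemma leaf_run {X : Type*} [DecidableEq X] (D : Finset (Finset X))
    (hD : ∀ e ∈ D, ∀ f, f ⊆ e → f ∈ D) (Y : Finset X) (P : List X) (j : ℕ) (hj : 1 ≤ j)
    (hnd : P.Nodup) (hlen : P.length = j) (σ : List Bool) (k : ℕ) :
    ∀ (W : Finset X) (v : List X), P.toFinset ⊆ W → VY D Y (List.replicate k false ++ σ) P W v →
      ∃ W' v', VY D Y σ P W' v' ∧ P.toFinset ⊆ W' ∧ W' ∪ v'.toFinset = W ∪ v.toFinset ∧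
        W' \ Y = W \ Y ∧ (bad D Y W : ℝ) + k * ((2 ^ j - 1) / j * cn Y P) ≤ bad D Y W' := by
  induction k with
  | zero =>
    intro W v hP h
    exact ⟨W, v, h, hP, rfl, rfl, by simp⟩
  | succ k ih =>
    intro W v hP h
    rw [List.replicate_succ, List.cons_append] at h
    obtain ⟨w, vs, rfl, hw, hwP, hwY, h'⟩ := VY_cons h
    have hwY := hwY rfl
    simp only [Bool.false_eq_true, if_false] at h'
    obtain ⟨W', v', h1, h2, h3, h4, h5⟩ :=
      ih (insert w W) vs (hP.trans (Finset.subset_insert _ _)) h'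
    refine ⟨W', v', h1, h2, ?_, ?_, ?_⟩
    · rw [h3]; ext x; simp
    · rw [h4, Finset.insert_sdiff_of_mem _ hwY]
    · have := bad_in1 D hD Y W P w j hj hw hnd hlen hP hwP hwY
      push_cast
      linarith

lemma spine_run {X : Type*} [DecidableEq X] (D : Finset (Finset X))
    (hD : ∀ e ∈ D, ∀ f, f ⊆ e → f ∈ D) (Y : Finset X) (j : ℕ) (c : ℝ) (σ : List Bool)
    (A : List X) :
    ∀ (B : List X) (W : Finset X) (v : List X), (A ++ B).Nodup → (A ++ B).length = j →
      (A ++ B).toFinset ⊆ W → VY D Y (List.replicate A.length true ++ σ) (A ++ B) W v →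
      (c = 0 ∨ (c = 2 ^ (j - 1) ∧ 1 ≤ cn Y B)) →
      ∃ C W' v', C.length = A.length ∧ VY D Y σ (B ++ C) W' v' ∧ (B ++ C).Nodup ∧
        (B ++ C).toFinset ⊆ W' ∧ W' ∪ v'.toFinset = W ∪ v.toFinset ∧
        (W' \ Y).card = (W \ Y).card + cn Y C ∧
        (bad D Y W : ℝ) + 2 ^ j * cn Y C + c * (A.length - cn Y C) ≤ bad D Y W' := by
  induction A with
  | nil =>
    intro B W v hnd hlen hP h hc
    refine ⟨[], W, v, rfl, by simpa using h, by simpa using hnd, by simpa using hP, rfl, ?_, ?_⟩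
    · simp [cn]
    · simp [cn]
  | cons p A ih =>
    intro B W v hnd hlen hP h hc
    rw [List.length_cons, List.replicate_succ, List.cons_append] at h
    obtain ⟨w, vs, rfl, hw, hwP, -, h'⟩ := VY_cons h
    simp only [if_true, List.cons_append, List.tail_cons, List.append_assoc] at h'
    have hAB : ∀ x ∈ A ++ B, x ∈ W := by
      intro x hx
      apply hP
      rw [List.cons_append, List.toFinset_cons]
      exact Finset.mem_insert_of_mem (List.mem_toFinset.2 hx)
    have hnd' : (A ++ (B ++ [w])).Nodup := by
      rw [List.cons_append, List.nodup_cons] at hnd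
      rw [← List.append_assoc]
      refine List.Nodup.append hnd.2 (List.nodup_singleton _) ?_
      intro x hx hx'
      rw [List.mem_singleton] at hx'
      subst hx'
      exact hw (hAB _ hx)
    have hlen' : (A ++ (B ++ [w])).length = j := by
      simp at hlen ⊢; omega
    have hP' : (A ++ (B ++ [w])).toFinset ⊆ insert w W := by
      intro x hx
      rw [← List.append_assoc, List.mem_toFinset, List.mem_append, List.mem_singleton] at hx
      rcases hx with hx | hx
      · exact Finset.mem_insert_of_mem (hAB x hx)
      · rw [hx]; exact Finset.mem_insert_self _ _
    have hc' : c = 0 ∨ (c = 2 ^ (j - 1) ∧ 1 ≤ cn Y (B ++ [w])) := by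
      rcases hc with h | ⟨h, h1⟩
      · exact Or.inl h
      · exact Or.inr ⟨h, by rw [cn_append]; omega⟩
    obtain ⟨C, W', v', k1, k2, k3, k4, k5, k6, k7⟩ := ih (B ++ [w]) (insert w W) vs hnd' hlen' hP' h' hc'
    rw [List.append_assoc] at k2 k3 k4
    refine ⟨w :: C, W', v', by simp [k1], k2, k3, k4, ?_, ?_, ?_⟩
    · rw [k5]; ext x; simp
    · rw [k6, cn_cons]
      by_cases hwY : w ∈ Y
      · rw [Finset.insert_sdiff_of_mem _ hwY]; simp [hwY]
      · rw [Finset.insert_sdiff_of_notMem _ hwY, Finset.card_insert_of_notMem]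
        · simp [hwY]; omega
        · simp [hw]
    · rw [cn_cons, List.length_cons]
      by_cases hwY : w ∈ Y
      · have hb : (bad D Y W : ℝ) + c ≤ bad D Y (insert w W) := by
          rcases hc with h | ⟨h, h1⟩
          · rw [h]; have := bad_mono D Y W w; simpa using this
          · rw [h]
            exact bad_in2 D hD Y W _ w j hw hnd hlen hP hwP hwY (by rw [cn_append]; omega)
        simp only [hwY, not_true, if_false]
        push_cast
        linarith
      · have hb := bad_out D hD Y W _ w hw hP hwP hwY
        rw [List.toFinset_card_of_nodup hnd, hlen] at hb
        have hb' : (bad D Y W : ℝ) + 2 ^ j ≤ bad D Y (insert w W) := by exact_mod_cast hb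
        simp only [hwY, not_false_eq_true, if_true]
        push_cast
        linarith

lemma block_run {X : Type*} [DecidableEq X] (D : Finset (Finset X))
    (hD : ∀ e ∈ D, ∀ f, f ⊆ e → f ∈ D) (Y : Finset X) (j : ℕ) (hj : 1 ≤ j) (σ : List Bool)
    (P : List X) (W : Finset X) (v : List X) (l : ℕ) (s θ θ' : ℝ) (h0 : 0 ≤ θ) (h1 : θ ≤ 1)
    (hs : s = 2 ^ j + (2 ^ j - 1) / j * (l + θ' - θ))
    (hnd : P.Nodup) (hlen : P.length = j) (hP : P.toFinset ⊆ W)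
    (hpot : s * (W \ Y).card - (2 ^ j - 1) / j * θ * cn Y P ≤ bad D Y W)
    (h : VY D Y (List.replicate j true ++ (List.replicate l false ++ σ)) P W v) :
    ∃ P' W' v', VY D Y σ P' W' v' ∧ P'.Nodup ∧ P'.length = j ∧ P'.toFinset ⊆ W' ∧
      W' ∪ v'.toFinset = W ∪ v.toFinset ∧
      s * (W' \ Y).card - (2 ^ j - 1) / j * θ' * cn Y P' ≤ bad D Y W' := by
  obtain ⟨p, A, rfl⟩ : ∃ p A, P = p :: A := by
    cases P with
    | nil => simp at hlen; omega
    | cons p A => exact ⟨p, A, rfl⟩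
  have hAl : j = A.length + 1 := by simpa using hlen.symm
  have hj' : (0:ℝ) < j := by exact_mod_cast hj
  have h' := h
  rw [hAl, List.replicate_succ, List.cons_append] at h'
  obtain ⟨w, vs, rfl, hw, hwP, -, h'⟩ := VY_cons h'
  simp only [if_true, List.tail_cons] at h'
  have hAW : ∀ x ∈ A, x ∈ W := fun x hx => hP (by simp [hx])
  have hnd' : (A ++ [w]).Nodup := by
    refine List.Nodup.append (List.nodup_cons.1 hnd).2 (List.nodup_singleton _) ?_
    intro x hx hx'
    rw [List.mem_singleton] at hx'
    subst hx'
    exact hw (hAW _ hx)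
  have hP' : (A ++ [w]).toFinset ⊆ insert w W := by
    intro x hx
    rw [List.mem_toFinset, List.mem_append, List.mem_singleton] at hx
    rcases hx with hx | hx
    · exact Finset.mem_insert_of_mem (hAW x hx)
    · rw [hx]; exact Finset.mem_insert_self _ _
  have hlen' : (A ++ [w]).length = j := by simp [hAl]
  have ha : (0:ℝ) ≤ (2 ^ j - 1) / j := by
    apply div_nonneg _ hj'.le
    have : (1:ℝ) ≤ 2 ^ j := one_le_pow₀ (by norm_num)
    linarith
  have hx : (cn Y (p :: A) : ℝ) ≤ j := by
    have := cn_le Y (p :: A); rw [hlen] at this; exact_mod_cast this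
  have hx0 : (0 : ℝ) ≤ cn Y (p :: A) := Nat.cast_nonneg _
  -- the spine part of the block
  have spine : ∃ P' W' v', VY D Y (List.replicate l false ++ σ) P' W' v' ∧ P'.Nodup ∧
      P'.length = j ∧ P'.toFinset ⊆ W' ∧ W' ∪ v'.toFinset = W ∪ (w :: vs).toFinset ∧
      (W' \ Y).card = (W \ Y).card + cn Y P' ∧
      (bad D Y W : ℝ) + 2 ^ j * cn Y P' + (2 ^ j - 1) / j * θ * (cn Y (p :: A) - cn Y P')
        ≤ bad D Y W' := by
    by_cases hwY : w ∈ Y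
    · obtain ⟨C, W', v', k1, k2, k3, k4, k5, k6, k7⟩ :=
        spine_run D hD Y j 0 _ A [w] (insert w W) vs hnd' hlen' hP' h' (Or.inl rfl)
      have e1 : cn Y ([w] ++ C) = cn Y C := by
        rw [List.singleton_append, cn_cons]; simp [hwY]
      refine ⟨[w] ++ C, W', v', k2, k3, by simp [k1, hAl], k4, ?_, ?_, ?_⟩
      · rw [k5]; ext x; simp
      · rw [k6, e1, Finset.insert_sdiff_of_mem _ hwY]
      · have hb := bad_in1 D hD Y W (p :: A) w j hj hw hnd hlen hP hwP hwY
        rw [e1]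
        have hc0 : (0 : ℝ) ≤ cn Y C := Nat.cast_nonneg _
        have : (2 ^ j - 1) / j * θ * ((cn Y (p :: A) : ℝ) - cn Y C)
            ≤ (2 ^ j - 1) / j * cn Y (p :: A) := by
          rw [mul_assoc]
          apply mul_le_mul_of_nonneg_left _ ha
          nlinarith
        linarith
    · have e0 : cn Y [w] = 1 := by rw [cn_cons]; simp [hwY, cn]
      obtain ⟨C, W', v', k1, k2, k3, k4, k5, k6, k7⟩ :=
        spine_run D hD Y j (2 ^ (j - 1)) _ A [w] (insert w W) vs hnd' hlen' hP' h'
          (Or.inr ⟨rfl, e0.ge⟩)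
      have e1 : cn Y ([w] ++ C) = cn Y C + 1 := by
        rw [cn_append, e0]; omega
      refine ⟨[w] ++ C, W', v', k2, k3, by simp [k1, hAl], k4, ?_, ?_, ?_⟩
      · rw [k5]; ext x; simp
      · rw [k6, e1, Finset.insert_sdiff_of_notMem _ hwY, Finset.card_insert_of_notMem]
        · omega
        · simp [hw]
      · have hb := bad_out D hD Y W _ w hw hP hwP hwY
        rw [List.toFinset_card_of_nodup hnd, hlen] at hb
        have hb' : (bad D Y W : ℝ) + 2 ^ j ≤ bad D Y (insert w W) := by exact_mod_cast hb
        rw [e1]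
        have hcl : (cn Y C : ℝ) ≤ A.length := by
          have := cn_le Y C; rw [k1] at this; exact_mod_cast this
        have hjl : (j : ℝ) = A.length + 1 := by exact_mod_cast hAl
        have hp : ((2:ℝ) ^ j - 1) / j ≤ 2 ^ (j - 1) := by
          rw [div_le_iff₀ hj']
          have e2 : (2:ℝ) ^ j = 2 * 2 ^ (j - 1) := by
            rw [← pow_succ']; congr 1; omega
          rw [e2]
          have e3 : (1:ℝ) ≤ 2 ^ (j - 1) := one_le_pow₀ (by norm_num)
          rcases Nat.lt_or_ge 1 j with h2 | h2
          · have : (2:ℝ) ≤ j := by exact_mod_cast h2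
            nlinarith
          · have : j = 1 := by omega
            subst this; norm_num
        have : (2 ^ j - 1) / j * θ * ((cn Y (p :: A) : ℝ) - (cn Y C + 1))
            ≤ 2 ^ (j - 1) * (A.length - cn Y C) := by
          rw [mul_assoc]
          calc _ ≤ ((2:ℝ) ^ j - 1) / j * (A.length - cn Y C) := by
                apply mul_le_mul_of_nonneg_left _ ha
                nlinarith
            _ ≤ _ := by
                apply mul_le_mul_of_nonneg_right hp
                linarith
        push_cast
        linarith
  obtain ⟨P', W', v', k1, k2, k3, k4, k5, k6, k7⟩ := spine
  obtain ⟨Wb, vb, l1, l2, l3, l4, l5⟩ := leaf_run D hD Y P' j hj k2 k3 σ l W' v' k4 k1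
  refine ⟨P', Wb, vb, l1, k2, k3, l2, l3.trans k5, ?_⟩
  rw [l4, k6]
  push_cast
  have e : s * cn Y P' = 2 ^ j * cn Y P' + (2 ^ j - 1) / j * (l + θ' - θ) * cn Y P' := by
    conv_lhs => rw [hs]
    ring
  have : s * ((W \ Y).card + (cn Y P' : ℝ)) = s * (W \ Y).card + s * cn Y P' := by ring
  rw [this, e]
  linarith

/-! ### Patterns and counting of paths -/

def pat (j : ℕ) (l : ℕ → ℕ) : ℕ → ℕ → List Bool
  | _, 0 => []
  | b, k + 1 => List.replicate j true ++ (List.replicate (l b) false ++ pat j l (b + 1) k)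

lemma pat_true (j : ℕ) (l : ℕ → ℕ) (k : ℕ) : ∀ b, (pat j l b k).count true = j * k := by
  induction k with
  | zero => intro b; simp [pat]
  | succ k ih =>
    intro b
    simp only [pat, List.count_append, List.count_replicate, ih]
    simp; ring

lemma pat_false (j : ℕ) (F : ℕ → ℕ) (hF : Monotone F) (k : ℕ) :
    ∀ b, (pat j (fun b => F (b + 1) - F b) b k).count false + F b = F (b + k) := by
  induction k with
  | zero => intro b; simp [pat]
  | succ k ih =>
    intro b
    have h1 := ih (b + 1)
    have h2 : F b ≤ F (b + 1) := hF (Nat.le_succ b)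
    simp only [pat, List.count_append, List.count_replicate]
    simp
    rw [show b + (k + 1) = b + 1 + k by ring]
    omega

lemma pat_run {X : Type*} [DecidableEq X] (D : Finset (Finset X))
    (hD : ∀ e ∈ D, ∀ f, f ⊆ e → f ∈ D) (Y : Finset X) (j : ℕ) (hj : 1 ≤ j) (l : ℕ → ℕ)
    (s : ℝ) (θ : ℕ → ℝ) (h0 : ∀ b, 0 ≤ θ b) (h1 : ∀ b, θ b ≤ 1)
    (hs : ∀ b, s = 2 ^ j + (2 ^ j - 1) / j * (l b + θ (b + 1) - θ b)) (k : ℕ) :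
    ∀ (b : ℕ) (P : List X) (W : Finset X) (v : List X), P.Nodup → P.length = j → P.toFinset ⊆ W →
      s * (W \ Y).card - (2 ^ j - 1) / j * θ b * cn Y P ≤ bad D Y W →
      VY D Y (pat j l b k) P W v → θ (b + k) = 0 →
      s * ((W ∪ v.toFinset) \ Y).card ≤ bad D Y (W ∪ v.toFinset) := by
  induction k with
  | zero =>
    intro b P W v _ _ _ hpot h hθ
    cases v with
    | nil =>
      simp only [add_zero] at hθ
      rw [hθ] at hpot
      simpa using hpot
    | cons w vs => exact absurd h (by simp [VY, pat])
  | succ k ih =>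
    intro b P W v hnd hlen hP hpot h hθ
    obtain ⟨P', W', v', k1, k2, k3, k4, k5, k6⟩ :=
      block_run D hD Y j hj _ P W v (l b) s (θ b) (θ (b + 1)) (h0 b) (h1 b) (hs b) hnd hlen hP
        hpot h
    rw [← k5]
    exact ih (b + 1) P' W' v' k2 k3 k4 k6 k1 (by rw [← hθ]; congr 1; ring)

def pick {X : Type*} (c : Bool) : List Bool → List X → List X
  | (c' :: σ), (v :: vs) => if c' = c then v :: pick c σ vs else pick c σ vs
  | _, _ => []

lemma pick_length {X : Type*} (c : Bool) (σ : List Bool) :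
    ∀ v : List X, v.length = σ.length → (pick c σ v).length = σ.count c := by
  induction σ with
  | nil => intro v _; simp [pick]
  | cons c' σ ih =>
    intro v hv
    cases v with
    | nil => simp at hv
    | cons w vs =>
      have := ih vs (by simpa using hv)
      simp only [pick]
      by_cases h : c' = c
      · simp [h, this]
      · simp [h, this]

lemma pick_inj {X : Type*} (σ : List Bool) :
    ∀ v v' : List X, v.length = σ.length → v'.length = σ.length →
      pick true σ v = pick true σ v' → pick false σ v = pick false σ v' → v = v' := by
  induction σ with
  | nil => intro v v' h h' _ _; simp at h h'; rw [h, h']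
  | cons c σ ih =>
    intro v v' h h' h1 h2
    cases v with
    | nil => simp at h
    | cons w vs =>
      cases v' with
      | nil => simp at h'
      | cons w' vs' =>
        have ih' := ih vs vs' (by simpa using h) (by simpa using h')
        cases c
        · simp [pick] at h1 h2
          rw [h2.1, ih' h1 h2.2]
        · simp [pick] at h1 h2
          rw [h1.1, ih' h1.2 h2]

lemma pick_subset {X : Type*} (c : Bool) (σ : List Bool) :
    ∀ v : List X, ∀ x ∈ pick c σ v, x ∈ v := by
  induction σ with
  | nil => intro v x hx; simp [pick] at hx
  | cons c' σ ih =>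
    intro v x hx
    cases v with
    | nil => simp [pick] at hx
    | cons w vs =>
      simp only [pick] at hx
      split_ifs at hx
      · rcases List.mem_cons.1 hx with h | h
        · simp [h]
        · exact List.mem_cons_of_mem _ (ih vs x h)
      · exact List.mem_cons_of_mem _ (ih vs x hx)

def listsOf {X : Type*} [DecidableEq X] (Y : Finset X) : ℕ → Finset (List X)
  | 0 => {[]}
  | k + 1 => (Y ×ˢ listsOf Y k).image (fun p => p.1 :: p.2)

lemma listsOf_card {X : Type*} [DecidableEq X] (Y : Finset X) (k : ℕ) :
    (listsOf Y k).card ≤ Y.card ^ k := by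
  induction k with
  | zero => simp [listsOf]
  | succ k ih =>
    rw [listsOf, pow_succ']
    refine Finset.card_image_le.trans ?_
    rw [Finset.card_product]
    exact Nat.mul_le_mul_left _ ih

lemma mem_listsOf {X : Type*} [DecidableEq X] (Y : Finset X) (L : List X)
    (h : ∀ x ∈ L, x ∈ Y) : L ∈ listsOf Y L.length := by
  induction L with
  | nil => simp [listsOf]
  | cons w L ih =>
    rw [List.length_cons, listsOf, Finset.mem_image]
    exact ⟨(w, L), by simpa using ⟨h w (by simp), ih fun x hx => h x (by simp [hx])⟩, rfl⟩

def paths {X : Type*} [DecidableEq X] (H : Finset (Finset X)) (Z : Finset X) :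
    List Bool → List X → Finset X → Finset (List X)
  | [], _, _ => {[]}
  | c :: σ, P, W => (Z.filter (fun v => v ∉ W ∧ insert v P.toFinset ∈ H)).biUnion fun v =>
      (paths H Z σ (if c then P.tail ++ [v] else P) (insert v W)).image (fun vs => v :: vs)

lemma paths_spec {X : Type*} [DecidableEq X] (H : Finset (Finset X)) (Z : Finset X)
    (σ : List Bool) : ∀ (P : List X) (W : Finset X), ∀ v ∈ paths H Z σ P W,
      v.length = σ.length ∧ (∀ x ∈ v, x ∈ Z) ∧ ∀ (D : Finset (Finset X)) (Y : Finset X),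
        H ⊆ D → (∀ x ∈ pick false σ v, x ∈ Y) → VY D Y σ P W v := by
  induction σ with
  | nil =>
    intro P W v hv
    simp [paths] at hv
    subst hv
    simp [VY]
  | cons c σ ih =>
    intro P W v hv
    simp only [paths, Finset.mem_biUnion, Finset.mem_filter, Finset.mem_image] at hv
    obtain ⟨w, ⟨hwZ, hwW, hwH⟩, vs, hvs, rfl⟩ := hv
    obtain ⟨h1, h2, h3⟩ := ih _ _ vs hvs
    refine ⟨by simp [h1], ?_, ?_⟩
    · intro x hx
      rcases List.mem_cons.1 hx with h | h
      · rw [h]; exact hwZ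
      · exact h2 x h
    · intro D Y hHD hY
      refine ⟨hwW, hHD hwH, ?_, h3 D Y hHD ?_⟩
      · intro hc; subst hc
        exact hY w (by simp [pick])
      · intro x hx
        apply hY
        simp only [pick]
        split_ifs
        · exact List.mem_cons_of_mem _ hx
        · exact hx

def deg {X : Type*} [DecidableEq X] (H : Finset (Finset X)) (Z F : Finset X) : ℕ :=
  (Z.filter (fun v => v ∉ F ∧ insert v F ∈ H)).card

lemma paths_card {X : Type*} [DecidableEq X] (H : Finset (Finset X)) (Z : Finset X) (j K τ : ℕ)
    (hj : 1 ≤ j)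
    (hdeg : ∀ F : Finset X, F.card = j → (∃ e ∈ H, F ⊆ e) → K + τ ≤ deg H Z F)
    (σ : List Bool) : ∀ (P : List X) (W : Finset X), P.Nodup → P.length = j →
      P.toFinset ⊆ W → (∃ e ∈ H, P.toFinset ⊆ e) → W.card + σ.length ≤ τ →
      K ^ σ.length ≤ (paths H Z σ P W).card := by
  induction σ with
  | nil => intro P W _ _ _ _ _; simp [paths]
  | cons c σ ih =>
    intro P W hnd hlen hP hH hW
    rw [paths, Finset.card_biUnion]
    · have hge : K ≤ (Z.filter (fun v => v ∉ W ∧ insert v P.toFinset ∈ H)).card := by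
        have h1 := hdeg P.toFinset (by rw [List.toFinset_card_of_nodup hnd, hlen]) hH
        have h2 : Z.filter (fun v => v ∉ P.toFinset ∧ insert v P.toFinset ∈ H) ⊆
            (Z.filter (fun v => v ∉ W ∧ insert v P.toFinset ∈ H)) ∪ W := by
          intro x hx
          simp only [Finset.mem_filter, Finset.mem_union] at hx ⊢
          tauto
        have h3 := (Finset.card_le_card h2).trans (Finset.card_union_le _ _)
        unfold deg at h1
        simp only [List.length_cons] at hW
        omega
      calc K ^ (c :: σ).length = K * K ^ σ.length := by rw [List.length_cons, pow_succ']
        _ ≤ (Z.filter (fun v => v ∉ W ∧ insert v P.toFinset ∈ H)).card * K ^ σ.length :=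
            Nat.mul_le_mul_right _ hge
        _ ≤ _ := by
            rw [← smul_eq_mul]
            apply Finset.card_nsmul_le_sum
            intro w hw
            simp only [Finset.mem_filter] at hw
            obtain ⟨hwZ, hwW, hwH⟩ := hw
            rw [Finset.card_image_of_injective _ (fun a b h => by simpa using h)]
            have hWc : (insert w W).card + σ.length ≤ τ := by
              have := Finset.card_insert_le w W
              simp only [List.length_cons] at hW
              omega
            have hPW : P.toFinset ⊆ insert w W := hP.trans (Finset.subset_insert _ _)
            cases c
            · simp only [Bool.false_eq_true, if_false]
              exact ih P (insert w W) hnd hlen hPW hH hWc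
            · simp only [if_true]
              have hT : ∀ x ∈ P.tail, x ∈ P := fun x hx => List.mem_of_mem_tail hx
              have hsub : (P.tail ++ [w]).toFinset ⊆ insert w P.toFinset := by
                intro x hx
                rw [List.mem_toFinset, List.mem_append, List.mem_singleton] at hx
                rcases hx with hx | hx
                · exact Finset.mem_insert_of_mem (List.mem_toFinset.2 (hT x hx))
                · rw [hx]; exact Finset.mem_insert_self _ _
              apply ih (P.tail ++ [w]) (insert w W) _ _ _ ⟨_, hwH, hsub⟩ hWc
              · refine List.Nodup.append (hnd.sublist (List.tail_sublist P))
                  (List.nodup_singleton _) ?_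
                intro x hx hx'
                rw [List.mem_singleton] at hx'
                subst hx'
                exact hwW (hP (List.mem_toFinset.2 (hT _ hx)))
              · simp [hlen]; omega
              · exact hsub.trans (Finset.insert_subset_insert _ hP)
    · intro a _ b _ hab
      rw [Function.onFun, Finset.disjoint_left]
      intro L h1 h2
      obtain ⟨x, _, rfl⟩ := Finset.mem_image.1 h1
      obtain ⟨y, _, h⟩ := Finset.mem_image.1 h2
      simp at h
      exact hab h.1.symm

lemma paths_upper {X : Type*} [DecidableEq X] (A : Finset (List X)) (Z : Finset X) (m : ℕ)
    (σ : List Bool) (hlen : ∀ v ∈ A, v.length = σ.length) (hZ : ∀ v ∈ A, ∀ x ∈ v, x ∈ Z)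
    (Y : List X → Finset X) (hYm : ∀ r, (Y r).card ≤ m)
    (hY : ∀ v ∈ A, ∀ x ∈ v, x ∈ Y (pick false σ v)) :
    A.card ≤ m ^ (σ.count true) * Z.card ^ (σ.count false) := by
  have h := Finset.card_le_mul_card_image_of_maps_to (s := A) (f := pick false σ)
    (t := listsOf Z (σ.count false)) (n := m ^ (σ.count true)) ?_ ?_
  · exact h.trans (Nat.mul_le_mul_left _ (listsOf_card _ _))
  · intro v hv
    rw [← pick_length false σ v (hlen v hv)]
    exact mem_listsOf _ _ fun x hx => hZ v hv x (pick_subset _ _ _ x hx)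
  · intro r _
    have h1 : (A.filter (fun v => pick false σ v = r)).card ≤ (listsOf (Y r) (σ.count true)).card := by
      apply Finset.card_le_card_of_injOn (pick true σ)
      · intro v hv
        obtain ⟨hvA, hvr⟩ := Finset.mem_filter.1 hv
        rw [← pick_length true σ v (hlen v hvA)]
        apply mem_listsOf
        intro x hx
        rw [← hvr]
        exact hY v hvA x (pick_subset _ _ _ x hx)
      · intro v hv v' hv' hvv
        obtain ⟨hvA, hvr⟩ := Finset.mem_filter.1 hv
        obtain ⟨hvA', hvr'⟩ := Finset.mem_filter.1 hv'
        exact pick_inj σ v v' (hlen v hvA) (hlen v' hvA') hvv (hvr.trans hvr'.symm)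
    exact h1.trans ((listsOf_card _ _).trans (Nat.pow_le_pow_left (hYm r) _))

/-! ### Pruning -/

lemma prune {X : Type*} [DecidableEq X] (H₀ : Finset (Finset X)) (Z : Finset X) (j : ℕ)
    (hcard : ∀ e ∈ H₀, e.card = j + 1) (hZ : ∀ e ∈ H₀, e ⊆ Z) (hne : H₀.Nonempty) (d : ℝ)
    (hd : 0 ≤ d)
    (h0 : d * (H₀.biUnion (fun e => e.powersetCard j)).card ≤ H₀.card) :
    ∃ H, H ⊆ H₀ ∧ H.Nonempty ∧
      ∀ F : Finset X, F.card = j → (∃ e ∈ H, F ⊆ e) → d ≤ deg H Z F := by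
  let sh : Finset (Finset X) → Finset (Finset X) := fun H => H.biUnion (fun e => e.powersetCard j)
  let C := H₀.powerset.filter (fun H => H.Nonempty ∧ d * (sh H).card ≤ H.card)
  have hC : C.Nonempty := ⟨H₀, by simp only [C, Finset.mem_filter, Finset.mem_powerset]; exact ⟨subset_rfl, hne, h0⟩⟩
  obtain ⟨H, hH, hmin⟩ := C.exists_min_image (fun H => H.card) hC
  simp only [C, Finset.mem_filter, Finset.mem_powerset] at hH hmin
  obtain ⟨hHs, hHn, hHd⟩ := hH
  refine ⟨H, hHs, hHn, ?_⟩
  intro F hF hFe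
  by_contra hlt
  push Not at hlt
  obtain ⟨e, he, hFe⟩ := hFe
  set H' := H.filter (fun e => ¬ F ⊆ e) with hH'
  have hpart : (H.filter (fun e => F ⊆ e)).card + H'.card = H.card :=
    Finset.card_filter_add_card_filter_not _
  have hdeg : (H.filter (fun e => F ⊆ e)).card ≤ deg H Z F := by
    have : H.filter (fun e => F ⊆ e) ⊆
        (Z.filter (fun v => v ∉ F ∧ insert v F ∈ H)).image (fun v => insert v F) := by
      intro f hf
      obtain ⟨hfH, hFf⟩ := Finset.mem_filter.1 hf
      have hc : (f \ F).card = 1 := by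
        rw [Finset.card_sdiff_of_subset hFf, hcard f (hHs hfH), hF]; omega
      obtain ⟨v, hv⟩ := Finset.card_eq_one.1 hc
      have hvm : v ∈ f \ F := by rw [hv]; simp
      have hfe : insert v F = f := by
        rw [Finset.insert_eq, ← hv, Finset.sdiff_union_of_subset hFf]
      rw [Finset.mem_image]
      refine ⟨v, ?_, hfe⟩
      rw [Finset.mem_filter, hfe]
      exact ⟨hZ f (hHs hfH) (Finset.mem_sdiff.1 hvm).1, (Finset.mem_sdiff.1 hvm).2, hfH⟩
    exact (Finset.card_le_card this).trans Finset.card_image_le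
  have hFsh : F ∈ sh H := by
    simp only [sh, Finset.mem_biUnion, Finset.mem_powersetCard]
    exact ⟨e, he, hFe, hF⟩
  have hsh : sh H' ⊆ (sh H).erase F := by
    intro G hG
    simp only [sh, Finset.mem_biUnion, Finset.mem_powersetCard] at hG
    obtain ⟨f, hf, hGf, hGc⟩ := hG
    obtain ⟨hfH, hFf⟩ := Finset.mem_filter.1 hf
    rw [Finset.mem_erase]
    refine ⟨fun h => hFf (h ▸ hGf), ?_⟩
    simp only [sh, Finset.mem_biUnion, Finset.mem_powersetCard]
    exact ⟨f, hfH, hGf, hGc⟩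
  have hshc : (sh H').card + 1 ≤ (sh H).card := by
    have := Finset.card_le_card hsh
    rw [Finset.card_erase_of_mem hFsh] at this
    have : 0 < (sh H).card := Finset.card_pos.2 ⟨F, hFsh⟩
    omega
  have hshc' : ((sh H').card : ℝ) + 1 ≤ (sh H).card := by exact_mod_cast hshc
  have hdeg' : ((H.filter (fun e => F ⊆ e)).card : ℝ) ≤ deg H Z F := by exact_mod_cast hdeg
  have hpart' : ((H.filter (fun e => F ⊆ e)).card : ℝ) + H'.card = H.card := by
    exact_mod_cast hpart
  have hgt : d * (sh H').card < H'.card := by nlinarith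
  have hpos : (0:ℝ) < H'.card := lt_of_le_of_lt (by positivity) hgt
  have hH'n : H'.Nonempty := Finset.card_pos.1 (by exact_mod_cast hpos)
  have := hmin H' ⟨(Finset.filter_subset _ _).trans hHs, hH'n, hgt.le⟩
  have h1 : 0 < (H.filter (fun e => F ⊆ e)).card :=
    Finset.card_pos.2 ⟨e, Finset.mem_filter.2 ⟨he, hFe⟩⟩
  omega

lemma cnt_bad {X : Type*} [DecidableEq X] (D : Finset (Finset X)) (Y W : Finset X) :
    cnt D Y + bad D Y W ≤ cnt D (Y ∪ W \ Y) := by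
  rw [cnt, bad, cnt, ← Finset.card_union_of_disjoint]
  · apply Finset.card_le_card
    intro e he
    simp only [Finset.mem_union, Finset.mem_filter] at he ⊢
    rw [Finset.union_sdiff_self_eq_union]
    rcases he with h | h
    · exact ⟨h.1, h.2.trans Finset.subset_union_left⟩
    · exact ⟨h.1, h.2.1.trans Finset.subset_union_right⟩
  · rw [Finset.disjoint_left]
    intro e h1 h2
    simp only [Finset.mem_filter] at h1 h2
    exact h2.2.2 h1.2

/-- Number of members of size `i`. -/
def lev {X : Type*} [DecidableEq X] (D : Finset (Finset X)) (i : ℕ) : ℕ :=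
  (D.filter (fun e => e.card = i)).card

lemma key {X : Type*} [DecidableEq X] [Fintype X] (D : Finset (Finset X))
    (hD : ∀ e ∈ D, ∀ f, f ⊆ e → f ∈ D) (Z : Finset X) (hZ : ∀ e ∈ D, e ⊆ Z)
    (m M q p j n : ℕ) (s : ℝ) (hj : 1 ≤ j) (hq : 1 ≤ q) (hp : (q : ℝ) * (s - 1) = p)
    (hsj : (2 : ℝ) ^ j ≤ s) (hn : Z.card = n) (hn1 : 1 ≤ n)
    (hM : ∀ Y : Finset X, Y.card ≤ m → cnt D Y ≤ M)
    (hMs : (M : ℝ) + 2 * ((j + j * p : ℕ) : ℝ) * s ≤ s * m) :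
    (lev D (j + 1) : ℝ) ≤ 2 * m * (n : ℝ) ^ (1 - ((2 : ℝ) ^ j - 1) / (s - 1)) * lev D j := by
  set β : ℝ := 1 - ((2 : ℝ) ^ j - 1) / (s - 1) with hβ
  have h2j : (2:ℝ) ≤ 2 ^ j := by
    calc (2:ℝ) = 2 ^ 1 := by norm_num
      _ ≤ 2 ^ j := pow_le_pow_right₀ (by norm_num) hj
  have hs2 : 2 ≤ s := h2j.trans hsj
  have hs0 : 0 < s := by linarith
  have hs1 : 0 < s - 1 := by linarith
  set τ := j + j * p with hτ
  have hqR : (1:ℝ) ≤ q := by exact_mod_cast hq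
  have hjR : (1:ℝ) ≤ j := by exact_mod_cast hj
  -- natural number parameters
  obtain ⟨a, ha⟩ : ∃ a : ℕ, 2 ^ j = a + 1 := ⟨2 ^ j - 1, by have := Nat.one_le_two_pow (n := j); omega⟩
  have haR : (2:ℝ) ^ j = a + 1 := by exact_mod_cast ha
  have ha1 : 1 ≤ a := by
    have : (1:ℝ) ≤ a := by linarith
    exact_mod_cast this
  have haR1 : (1:ℝ) ≤ a := by exact_mod_cast ha1
  have hqa : q * a ≤ p := by
    have : (q * a : ℝ) ≤ p := by
      rw [← hp]; apply mul_le_mul_of_nonneg_left _ (by linarith); linarith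
    exact_mod_cast this
  set g := q * a with hg
  have hg1 : 1 ≤ g := Nat.mul_pos hq ha1
  have hgR : (0:ℝ) < g := by exact_mod_cast hg1
  obtain ⟨r, hr⟩ : ∃ r, p = g + r := ⟨p - g, by omega⟩
  set c := j * r with hc
  have hjp : j * p = j * g + c := by rw [hr, hc]; ring
  let F : ℕ → ℕ := fun b => c * b / g
  have hF : Monotone F := fun x y hxy => Nat.div_le_div_right (Nat.mul_le_mul_left _ hxy)
  let θ : ℕ → ℝ := fun b => ((c * b % g : ℕ) : ℝ) / g
  have hFθ : ∀ b, (F b : ℝ) + θ b = c * b / g := by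
    intro b
    have := Nat.div_add_mod (c * b) g
    have h' : (g : ℝ) * F b + ((c * b % g : ℕ) : ℝ) = c * b := by exact_mod_cast this
    simp only [θ]
    field_simp
    linarith
  have hθ0 : ∀ b, 0 ≤ θ b := fun b => by positivity
  have hθ1 : ∀ b, θ b ≤ 1 := by
    intro b
    simp only [θ]
    rw [div_le_one hgR]
    exact_mod_cast (Nat.mod_lt _ hg1).le
  have hsl : ∀ b, s = 2 ^ j + (2 ^ j - 1) / j * (((F (b + 1) - F b : ℕ) : ℝ) + θ (b + 1) - θ b) := by
    intro b
    rw [Nat.cast_sub (hF (Nat.le_succ b))]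
    have h1 := hFθ b
    have h2 := hFθ (b + 1)
    have h3 : (F (b + 1) : ℝ) - F b + θ (b + 1) - θ b = c / g := by
      have : (c : ℝ) * ((b + 1 : ℕ) : ℝ) / g = c * b / g + c / g := by push_cast; ring
      linarith
    rw [h3, haR, hc, hg]
    push_cast
    have h4 : (q : ℝ) * (s - 1) = q * a + r := by
      rw [hp, hr, hg]; push_cast; ring
    field_simp
    linear_combination (a:ℝ) * h4
  set l : ℕ → ℕ := fun b => F (b + 1) - F b with hl
  set σ := pat j l 0 g with hσ
  have hct : σ.count true = j * g := pat_true j l g 0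
  have hcf : σ.count false = c := by
    have := pat_false j F hF g 0
    simp only [F, Nat.mul_zero, Nat.zero_div, add_zero, zero_add, Nat.mul_div_cancel _ hg1] at this
    exact this
  have hσl : σ.length = j * p := by
    rw [hjp, ← hct, ← hcf, List.count_true_add_count_false]
  have hθg : θ (0 + g) = 0 := by simp [θ]
  -- sizes
  have hτm : 2 * τ ≤ m := by
    have : (2 * τ : ℝ) * s ≤ m * s := by
      have : (0:ℝ) ≤ M := Nat.cast_nonneg _
      linarith
    have := le_of_mul_le_mul_right this hs0
    exact_mod_cast this
  have hτ1 : 1 ≤ τ := by omega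
  have hτm' : (τ : ℝ) < m := by exact_mod_cast (by omega : τ < m)
  have hmR : (1:ℝ) ≤ m := by exact_mod_cast (by omega : 1 ≤ m)
  have hnR : (1:ℝ) ≤ n := by exact_mod_cast hn1
  have hβ0 : 0 ≤ β := by
    rw [hβ, sub_nonneg, div_le_one hs1]; linarith
  have hnβ : 1 ≤ (n:ℝ) ^ β := Real.one_le_rpow hnR hβ0
  by_contra hcon
  push Not at hcon
  set d : ℝ := 2 * m * (n : ℝ) ^ β with hd
  have hd0 : 0 ≤ d := by positivity
  have hmn : (m : ℝ) ≤ m * (n:ℝ) ^ β := le_mul_of_one_le_right (by linarith) hnβ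
  set H₀ := D.filter (fun e => e.card = j + 1) with hH₀
  have hH₀n : H₀.Nonempty := by
    rw [← Finset.card_pos]
    have : (0:ℝ) < lev D (j + 1) := lt_of_le_of_lt (by positivity) hcon
    exact_mod_cast this
  have hsh : (H₀.biUnion (fun e => e.powersetCard j)).card ≤ lev D j := by
    apply Finset.card_le_card
    intro f hf
    simp only [Finset.mem_biUnion, Finset.mem_powersetCard, H₀, Finset.mem_filter] at hf ⊢
    obtain ⟨e, he, hfe, hfc⟩ := hf
    exact ⟨hD e he.1 f hfe, hfc⟩
  obtain ⟨H, hHs, ⟨e₀, he₀⟩, hdeg⟩ := prune H₀ Z j (fun e he => (Finset.mem_filter.1 he).2)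
    (fun e he => hZ e (Finset.mem_filter.1 he).1) hH₀n d hd0 (by
      refine le_trans ?_ hcon.le
      apply mul_le_mul_of_nonneg_left _ hd0
      exact_mod_cast hsh)
  have hHD : H ⊆ D := hHs.trans (Finset.filter_subset _ _)
  obtain ⟨F₀, hF₀e, hF₀c⟩ := Finset.exists_subset_card_eq
    (show j ≤ e₀.card by rw [(Finset.mem_filter.1 (hHs he₀)).2]; omega)
  set P₀ := F₀.toList with hP₀
  have hP₀f : P₀.toFinset = F₀ := Finset.toList_toFinset F₀
  have hP₀l : P₀.length = j := by rw [hP₀, Finset.length_toList, hF₀c]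
  have hP₀n : P₀.Nodup := Finset.nodup_toList F₀
  -- lower bound on number of paths
  set K := ⌈d⌉₊ - τ with hK
  have hτd : τ ≤ ⌈d⌉₊ := by
    have : (τ : ℝ) ≤ ⌈d⌉₊ := by
      refine le_trans ?_ (Nat.le_ceil d)
      rw [hd]; linarith
    exact_mod_cast this
  have hKR : (m : ℝ) * (n:ℝ) ^ β < K := by
    rw [hK, Nat.cast_sub hτd]
    have := Nat.le_ceil d
    have h5 : d = m * (n:ℝ) ^ β + m * (n:ℝ) ^ β := by rw [hd]; ring
    linarith
  have hlow := paths_card H Z j K τ hj (by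
    intro G hG hGe
    have := Nat.ceil_le.2 (hdeg G hG hGe)
    omega) σ P₀ F₀ hP₀n hP₀l hP₀f.le ⟨e₀, he₀, by rw [hP₀f]; exact hF₀e⟩ (by
      rw [hσl, hF₀c])
  -- closure
  have hcl : ∀ r : List X, ∃ Y : Finset X, Y.card ≤ m ∧ ((F₀ ∪ r.toFinset).card ≤ τ →
      F₀ ∪ r.toFinset ⊆ Y ∧ ∀ U : Finset X, Disjoint U Y → U.card ≤ τ →
        (cnt D Y : ℝ) + s * U.card ≤ cnt D (Y ∪ U) → U = ∅) := by
    intro r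
    by_cases hrc : (F₀ ∪ r.toFinset).card ≤ τ
    · obtain ⟨Y, h1, h2, h3⟩ := closure_exists D m M τ s hs0 hM hMs _ hrc
      exact ⟨Y, h2, fun _ => ⟨h1, h3⟩⟩
    · exact ⟨∅, by simp, fun h => absurd h hrc⟩
  choose Y hYm hY using hcl
  have hup := paths_upper (paths H Z σ P₀ F₀) Z m σ
    (fun v hv => (paths_spec H Z σ P₀ F₀ v hv).1) (fun v hv => (paths_spec H Z σ P₀ F₀ v hv).2.1)
    Y hYm (by
      intro v hv
      obtain ⟨hvl, hvZ, hvV⟩ := paths_spec H Z σ P₀ F₀ v hv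
      set y := Y (pick false σ v) with hy
      have hvc : (F₀ ∪ v.toFinset).card ≤ τ := by
        have h1 := Finset.card_union_le F₀ v.toFinset
        have h2 := List.toFinset_card_le v
        rw [hvl, hσl] at h2
        omega
      have hsubs : F₀ ∪ (pick false σ v).toFinset ⊆ F₀ ∪ v.toFinset := by
        apply Finset.union_subset_union_right
        intro x hx
        exact List.mem_toFinset.2 (pick_subset _ _ _ x (List.mem_toFinset.1 hx))
      obtain ⟨hRy, hclosed⟩ := hY (pick false σ v) ((Finset.card_le_card hsubs).trans hvc)
      have hV := hvV D y hHD (fun x hx => hRy (Finset.mem_union_right _ (List.mem_toFinset.2 hx)))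
      have hF₀y : F₀ \ y = ∅ :=
        Finset.sdiff_eq_empty_iff_subset.2 (Finset.subset_union_left.trans hRy)
      have hgain := pat_run D hD y j hj l s θ hθ0 hθ1 hsl g 0 P₀ F₀ v hP₀n hP₀l hP₀f.le (by
        rw [hF₀y]
        have h1 : θ 0 = 0 := by simp [θ]
        rw [h1]; simp) hV hθg
      have hemp := hclosed ((F₀ ∪ v.toFinset) \ y) Finset.sdiff_disjoint
        ((Finset.card_le_card Finset.sdiff_subset).trans hvc) (by
          have h1 := cnt_bad D y (F₀ ∪ v.toFinset)
          have h2 : (cnt D y : ℝ) + bad D y (F₀ ∪ v.toFinset) ≤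
            cnt D (y ∪ (F₀ ∪ v.toFinset) \ y) := by exact_mod_cast h1
          linarith)
      intro x hx
      exact Finset.sdiff_eq_empty_iff_subset.1 hemp
        (Finset.mem_union_right _ (List.mem_toFinset.2 hx)))
  rw [hct, hcf, hn] at hup
  rw [hσl] at hlow
  have hfin : (K : ℝ) ^ (j * p) ≤ (m : ℝ) ^ (j * g) * (n : ℝ) ^ c := by
    exact_mod_cast hlow.trans hup
  have hjp0 : j * p ≠ 0 := by
    have : 0 < j * g := Nat.mul_pos hj hg1
    omega
  have h1 : ((m : ℝ) * (n:ℝ) ^ β) ^ (j * p) < (K : ℝ) ^ (j * p) :=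
    pow_lt_pow_left₀ hKR (by positivity) hjp0
  have h2 : ((n:ℝ) ^ β) ^ (j * p) = (n : ℝ) ^ c := by
    rw [← Real.rpow_natCast, ← Real.rpow_mul (by linarith), ← Real.rpow_natCast]
    congr 1
    have h4 : (c : ℝ) = (j * p : ℕ) - j * g := by rw [hjp]; push_cast; ring
    rw [h4, hβ, haR, hg]
    push_cast
    rw [← hp]
    field_simp
    ring
  rw [mul_pow, h2] at h1
  have h3 : (m : ℝ) ^ (j * g) ≤ (m : ℝ) ^ (j * p) := pow_le_pow_right₀ hmR (by omega)
  have h4 : (m : ℝ) ^ (j * g) * (n : ℝ) ^ c ≤ (m : ℝ) ^ (j * p) * (n : ℝ) ^ c :=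
    mul_le_mul_of_nonneg_right h3 (by positivity)
  linarith

lemma big_faces {X : Type*} [DecidableEq X] [Fintype X] (D : Finset (Finset X))
    (hD : ∀ e ∈ D, ∀ f, f ⊆ e → f ∈ D) (m M k : ℕ) (s : ℝ) (hs : 0 < s) (hk : 1 ≤ k)
    (hsk : s ≤ (2 : ℝ) ^ k)
    (hM : ∀ Y : Finset X, Y.card ≤ m → cnt D Y ≤ M)
    (hMs : (M : ℝ) + 2 * (k : ℝ) * s ≤ s * m) :
    (D.filter (fun e => k ≤ e.card)).card ≤ lev D k * M := by
  have hF : ∀ F ∈ D.filter (fun e => e.card = k), (D.filter (fun e => F ⊆ e)).card ≤ M := by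
    intro F hF
    obtain ⟨hFD, hFc⟩ := Finset.mem_filter.1 hF
    obtain ⟨Y, h1, h2, h3⟩ := closure_exists D m M k s hs hM hMs F hFc.le
    refine le_trans (Finset.card_le_card ?_) (hM Y h2)
    intro e he
    obtain ⟨heD, hFe⟩ := Finset.mem_filter.1 he
    refine Finset.mem_filter.2 ⟨heD, ?_⟩
    intro v hv
    by_contra hvY
    have hb := bad_out D hD Y Y F v hvY h1
      (hD e heD _ (Finset.insert_subset hv hFe)) hvY
    have hc := cnt_bad D Y (insert v Y)
    rw [hFc] at hb
    have he : insert v Y \ Y = {v} := by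
      ext x; simp only [Finset.mem_sdiff, Finset.mem_insert, Finset.mem_singleton]
      constructor
      · tauto
      · rintro rfl; exact ⟨Or.inl rfl, hvY⟩
    rw [he] at hc
    have := h3 {v} (by simpa using hvY) (by simpa using hk) (by
      have : (cnt D Y : ℝ) + 2 ^ k ≤ cnt D (Y ∪ {v}) := by
        have : cnt D Y + 2 ^ k ≤ cnt D (Y ∪ {v}) := by omega
        exact_mod_cast this
      simp only [Finset.card_singleton, Nat.cast_one, mul_one]
      linarith)
    simp at this
  have hsub : D.filter (fun e => k ≤ e.card) ⊆
      (D.filter (fun e => e.card = k)).biUnion (fun F => D.filter (fun e => F ⊆ e)) := by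
    intro e he
    obtain ⟨heD, hke⟩ := Finset.mem_filter.1 he
    obtain ⟨F, hFe, hFc⟩ := Finset.exists_subset_card_eq hke
    rw [Finset.mem_biUnion]
    exact ⟨F, Finset.mem_filter.2 ⟨hD e heD F hFe, hFc⟩, Finset.mem_filter.2 ⟨heD, hFe⟩⟩
  exact (Finset.card_le_card hsub).trans (Finset.card_biUnion_le_card_mul _ _ _ hF)

lemma small_faces {X : Type*} [DecidableEq X] (D : Finset (Finset X)) (k : ℕ) :
    D.card = ∑ i ∈ Finset.range k, lev D i + (D.filter (fun e => k ≤ e.card)).card := by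
  induction k with
  | zero => simp
  | succ k ih =>
    rw [Finset.sum_range_succ, ih, add_assoc]
    congr 1
    rw [lev, ← Finset.card_union_of_disjoint]
    · congr 1
      ext e
      simp only [Finset.mem_filter, Finset.mem_union]
      constructor
      · rintro ⟨h1, h2⟩
        rcases Nat.lt_or_ge k e.card with h | h
        · exact Or.inr ⟨h1, h⟩
        · exact Or.inl ⟨h1, by omega⟩
      · rintro (⟨h1, h2⟩ | ⟨h1, h2⟩)
        · exact ⟨h1, by omega⟩
        · exact ⟨h1, by omega⟩
    · rw [Finset.disjoint_left]
      intro e h1 h2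
      simp only [Finset.mem_filter] at h1 h2
      omega

lemma lev_zero {X : Type*} [DecidableEq X] (D : Finset (Finset X)) : lev D 0 ≤ 1 := by
  rw [lev, Finset.card_le_one]
  intro a ha b hb
  simp only [Finset.mem_filter, Finset.card_eq_zero] at ha hb
  rw [ha.2, hb.2]

lemma lev_one {X : Type*} [DecidableEq X] (D : Finset (Finset X)) (Z : Finset X)
    (hZ : ∀ e ∈ D, e ⊆ Z) : lev D 1 ≤ Z.card := by
  have : D.filter (fun e => e.card = 1) ⊆ Z.powersetCard 1 := by
    intro e he
    obtain ⟨h1, h2⟩ := Finset.mem_filter.1 he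
    exact Finset.mem_powersetCard.2 ⟨hZ e h1, h2⟩
  have := Finset.card_le_card this
  simpa [lev] using this

set_option maxHeartbeats 1600000 in
lemma down_bound {X : Type*} [DecidableEq X] [Fintype X] (D : Finset (Finset X))
    (hD : ∀ e ∈ D, ∀ f, f ⊆ e → f ∈ D) (Z : Finset X) (hZ : ∀ e ∈ D, e ⊆ Z)
    (m M q p t n : ℕ) (s : ℝ) (ht : 1 ≤ t) (hq : 1 ≤ q) (hp : (q : ℝ) * (s - 1) = p)
    (hst : (2 : ℝ) ^ t ≤ s) (hst' : s ≤ 2 ^ (t + 1)) (hn : Z.card = n) (hn1 : 1 ≤ n)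
    (hM : ∀ Y : Finset X, Y.card ≤ m → cnt D Y ≤ M)
    (hMs : (M : ℝ) + 3 * q * s ^ 2 * t ≤ s * m) :
    (D.card : ℝ) ≤ 2 ^ (t + 2) * (m : ℝ) ^ (2 * t + 2) *
          (n : ℝ) ^ ((t : ℝ) + 1 - ((2 : ℝ) ^ (t + 1) - t - 2) / (s - 1)) := by
  have h2t : (2:ℝ) ≤ 2 ^ t := by
    calc (2:ℝ) = 2 ^ 1 := by norm_num
      _ ≤ 2 ^ t := pow_le_pow_right₀ (by norm_num) ht
  have hs2 : 2 ≤ s := h2t.trans hst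
  have hs0 : 0 < s := by linarith
  have hs1 : 0 < s - 1 := by linarith
  have hqR : (1:ℝ) ≤ q := by exact_mod_cast hq
  have htR : (1:ℝ) ≤ t := by exact_mod_cast ht
  have hnR : (1:ℝ) ≤ n := by exact_mod_cast hn1
  have hM0 : (0:ℝ) ≤ M := Nat.cast_nonneg _
  have hqst : s * t ≤ q * s * t := by nlinarith [mul_pos hs0 (by linarith : (0:ℝ) < t)]
  have hm3 : 3 * (s * t) ≤ m := by
    have : s * (3 * (q * s * t)) ≤ s * m := by nlinarith
    have := le_of_mul_le_mul_left this hs0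
    linarith
  have hms : s ≤ m := by nlinarith
  have hmt : (t:ℝ) + 1 ≤ m := by nlinarith
  have hmR : (1:ℝ) ≤ m := by linarith
  let α : ℕ → ℝ := fun i => (i : ℝ) + 1 - ((2 : ℝ) ^ (i + 1) - i - 2) / (s - 1)
  have hβ : ∀ j, j ≤ t → 0 ≤ 1 - ((2 : ℝ) ^ j - 1) / (s - 1) := by
    intro j hj
    have : (2:ℝ) ^ j ≤ 2 ^ t := pow_le_pow_right₀ (by norm_num) hj
    rw [sub_nonneg, div_le_one hs1]; linarith
  have hα : ∀ i, α (i + 1) = α i + (1 - ((2 : ℝ) ^ (i + 1) - 1) / (s - 1)) := by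
    intro i
    simp only [α]
    push_cast
    field_simp
    ring
  have hα0 : α 0 = 1 := by simp [α]
  have hαmono : ∀ k i, i + k ≤ t → α i ≤ α (i + k) := by
    intro k
    induction k with
    | zero => intro i _; exact le_rfl
    | succ k ih =>
      intro i hi
      have h1 := ih i (by omega)
      have h2 := hα (i + k)
      have h3 := hβ (i + k + 1) (by omega)
      rw [← add_assoc]
      linarith
  have hlev : ∀ i, i ≤ t → (lev D (i + 1) : ℝ) ≤ (2 * m) ^ i * (n : ℝ) ^ α i := by
    intro i
    induction i with
    | zero =>
      intro _
      rw [hα0]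
      simp only [zero_add, pow_zero, one_mul, Real.rpow_one]
      rw [← hn]; exact_mod_cast lev_one D Z hZ
    | succ j ih =>
      intro hj
      have h1 := ih (by omega)
      have h2j : (2:ℝ) ^ (j + 1) ≤ 2 ^ t := pow_le_pow_right₀ (by norm_num) hj
      have h2 := key D hD Z hZ m M q p (j + 1) n s (by omega) hq hp (h2j.trans hst) hn hn1 hM (by
        refine le_trans ?_ hMs
        have hjt : ((j + 1 : ℕ) : ℝ) ≤ t := by exact_mod_cast hj
        have e1 : (((j + 1) + (j + 1) * p : ℕ) : ℝ) = ((j + 1 : ℕ) : ℝ) * (1 + q * (s - 1)) := by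
          rw [hp]; push_cast; ring
        have e2 : (((j + 1) + (j + 1) * p : ℕ) : ℝ) ≤ t * (q * s) := by
          rw [e1]
          apply mul_le_mul hjt _ (by nlinarith) (by linarith)
          linarith
        have e3 : 2 * (((j + 1) + (j + 1) * p : ℕ) : ℝ) * s ≤ 2 * (t * (q * s)) * s := by
          apply mul_le_mul_of_nonneg_right _ hs0.le
          linarith
        have e4 : 0 ≤ q * s ^ 2 * t := by positivity
        nlinarith)
      rw [hα, Real.rpow_add (by linarith)]
      calc (lev D (j + 1 + 1) : ℝ) ≤ _ := h2
        _ ≤ 2 * m * (n : ℝ) ^ (1 - ((2 : ℝ) ^ (j + 1) - 1) / (s - 1)) *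
            ((2 * m) ^ j * (n : ℝ) ^ α j) := mul_le_mul_of_nonneg_left h1 (by positivity)
        _ = _ := by ring
  have hαt : 1 ≤ α t := by
    have := hαmono t 0 (by omega)
    rw [hα0, zero_add] at this; exact this
  set B : ℝ := (2 * m) ^ t * (n : ℝ) ^ α t with hB
  have hnα : 1 ≤ (n:ℝ) ^ α t := Real.one_le_rpow hnR (by linarith)
  have hB1 : 1 ≤ B := by
    have : (1:ℝ) ≤ (2 * m) ^ t := one_le_pow₀ (by linarith)
    nlinarith
  have hlevB : ∀ i, i ≤ t + 1 → (lev D i : ℝ) ≤ B := by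
    intro i hi
    cases i with
    | zero =>
      have : (lev D 0 : ℝ) ≤ 1 := by exact_mod_cast lev_zero D
      linarith
    | succ i =>
      refine (hlev i (by omega)).trans ?_
      apply mul_le_mul _ _ (by positivity) (by positivity)
      · exact pow_le_pow_right₀ (by linarith) (by omega)
      · apply Real.rpow_le_rpow_of_exponent_le hnR
        have := hαmono (t - i) i (by omega)
        rwa [show i + (t - i) = t by omega] at this
  have hbig := big_faces D hD m M (t + 1) s hs0 (by omega) hst' hM (by
    refine le_trans ?_ hMs
    push_cast
    have e1 : 2 * ((t:ℝ) + 1) ≤ 3 * (q * s * t) := by nlinarith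
    have e2 := mul_le_mul_of_nonneg_right e1 hs0.le
    nlinarith)
  have htot := small_faces D (t + 1)
  have htotR : (D.card : ℝ) ≤ ∑ i ∈ Finset.range (t + 1), (lev D i : ℝ) + lev D (t + 1) * M := by
    have : D.card ≤ ∑ i ∈ Finset.range (t + 1), lev D i + lev D (t + 1) * M := by omega
    exact_mod_cast this
  have hsum : ∑ i ∈ Finset.range (t + 1), (lev D i : ℝ) ≤ (t + 1) * B := by
    have := Finset.sum_le_card_nsmul (Finset.range (t + 1)) (fun i => (lev D i : ℝ)) B
      (fun i hi => hlevB i (by have := Finset.mem_range.1 hi; omega))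
    simpa using this
  have hMm : (M:ℝ) ≤ s * m := by
    have : 0 ≤ 3 * (q:ℝ) * s ^ 2 * t := by positivity
    linarith
  have h1 : (D.card : ℝ) ≤ (t + 1 + s * m) * B := by
    have h2 : (lev D (t + 1) : ℝ) * M ≤ B * (s * m) :=
      mul_le_mul (hlevB (t + 1) le_rfl) hMm hM0 (by linarith)
    linarith
  have h2 : (t:ℝ) + 1 + s * m ≤ 4 * (m : ℝ) ^ (t + 2) := by
    have e1 : (m:ℝ) ^ 2 ≤ (m:ℝ) ^ (t + 2) := pow_le_pow_right₀ hmR (by omega)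
    have e2 : s * m ≤ m * m := mul_le_mul_of_nonneg_right hms (by linarith)
    have e3 : (m:ℝ) * 1 ≤ m * m := mul_le_mul_of_nonneg_left hmR (by linarith)
    have e4 : (m:ℝ) ^ 2 = m * m := sq _
    linarith
  calc (D.card : ℝ) ≤ (t + 1 + s * m) * B := h1
    _ ≤ 4 * (m : ℝ) ^ (t + 2) * B := mul_le_mul_of_nonneg_right h2 (by linarith)
    _ = _ := by
      rw [hB, mul_pow]
      simp only [α]
      ring

lemma shatter_ge {X : Type*} [DecidableEq X] [Fintype X] (S : Finset (Finset X)) (m : ℕ)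
    (Y : Finset X) (hY : Y.card = m) : (S.image (· ∩ Y)).card ≤ shatter S m := by
  unfold shatter
  exact Finset.le_sup (f := fun Y => (S.image (· ∩ Y)).card)
    (Finset.mem_powersetCard.2 ⟨Finset.subset_univ _, hY⟩)

end RSB

/-- **Theorem (rational case).** Let `s ≥ 2` be rational with denominator `q`, and
`t = ⌊log₂ s⌋`. Let `m ≥ 1`. For any finite set system `S`, if
`f_S(m) ≤ s·m − 3q·s²·log₂ s`, then for all `n ≥ m`,
`f_S(n) ≤ 2^(t+2) · m^(2t+2) · n^(t+1−(2^(t+1)−t−2)/(s−1))`. -/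
theorem rational_shatter_bound {X : Type*} [DecidableEq X] [Fintype X]
    (s : ℚ) (hs : 2 ≤ s) (q : ℕ) (hq : q = s.den)
    (t : ℕ) (ht : (t : ℤ) = ⌊Real.logb 2 (s : ℝ)⌋)
    (m : ℕ) (hm : 1 ≤ m)
    (S : Finset (Finset X))
    (hS : (shatter S m : ℝ) ≤ (s : ℝ) * m - 3 * q * (s : ℝ) ^ 2 * Real.logb 2 (s : ℝ)) :
    ∀ n : ℕ, m ≤ n →
      (shatter S n : ℝ) ≤
        2 ^ (t + 2) * (m : ℝ) ^ (2 * t + 2) *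
          (n : ℝ) ^ ((t : ℝ) + 1 - ((2 : ℝ) ^ (t + 1) - t - 2) / ((s : ℝ) - 1)) := by
  have hs2 : (2:ℝ) ≤ (s:ℝ) := by exact_mod_cast hs
  have hs0 : (0:ℝ) < (s:ℝ) := by linarith
  have hlog1 : 1 ≤ Real.logb 2 (s:ℝ) := by
    rw [Real.le_logb_iff_rpow_le (by norm_num) hs0]; simpa using hs2
  have hfl := Int.floor_le (Real.logb 2 (s:ℝ))
  have hfl' := Int.lt_floor_add_one (Real.logb 2 (s:ℝ))
  rw [← ht] at hfl hfl'
  push_cast at hfl hfl'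
  have ht1 : 1 ≤ t := by
    have : (1:ℤ) ≤ ⌊Real.logb 2 (s:ℝ)⌋ := Int.le_floor.2 (by exact_mod_cast hlog1)
    omega
  have hst : (2:ℝ) ^ t ≤ s := by
    rw [Real.le_logb_iff_rpow_le (by norm_num) hs0, Real.rpow_natCast] at hfl
    exact hfl
  have hst' : (s:ℝ) ≤ 2 ^ (t + 1) := by
    have h := hfl'.le
    rw [Real.logb_le_iff_le_rpow (by norm_num) hs0] at h
    exact_mod_cast h
  have hq1 : 1 ≤ q := by rw [hq]; exact s.pos
  have hp : (q : ℝ) * ((s:ℝ) - 1) = ((s.num - s.den).toNat : ℕ) := by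
    have hQ : (s.den : ℚ) * s = s.num := Rat.den_mul_eq_num s
    have hR : (s.den : ℝ) * (s : ℝ) = s.num := by exact_mod_cast hQ
    have hnn : (0:ℤ) ≤ s.num - s.den := by
      have h1 : (0:ℚ) ≤ s.num - s.den := by
        rw [← hQ]
        have : (0:ℚ) < s.den := by exact_mod_cast s.pos
        nlinarith
      exact_mod_cast h1
    have h2 : (((s.num - s.den).toNat : ℕ) : ℤ) = s.num - s.den := Int.toNat_of_nonneg hnn
    have h3 : (((s.num - s.den).toNat : ℕ) : ℝ) = s.num - s.den := by exact_mod_cast h2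
    rw [h3, hq, mul_sub, hR, mul_one]
  intro n hn
  by_cases hX : n ≤ Fintype.card X
  · have hne : (Finset.univ.powersetCard n : Finset (Finset X)).Nonempty := by
      apply Finset.powersetCard_nonempty_of_le
      simpa using hX
    obtain ⟨Z, hZ, hZs⟩ := Finset.exists_mem_eq_sup _ hne (fun Y => (S.image (· ∩ Y)).card)
    have hZc : Z.card = n := (Finset.mem_powersetCard.1 hZ).2
    obtain ⟨D, hDc, hDZ, hD, hDT⟩ := RSB.exists_down (S.image (· ∩ Z)) Z (by
      intro e he
      obtain ⟨f, _, rfl⟩ := Finset.mem_image.1 he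
      exact Finset.inter_subset_right)
    have hsh : shatter S n = D.card := by rw [hDc]; exact hZs
    have hM : ∀ Y : Finset X, Y.card ≤ m → RSB.cnt D Y ≤ shatter S m := by
      intro Y hY
      obtain ⟨Y', hYY', hY'⟩ := Finset.exists_superset_card_eq hY (hn.trans hX)
      refine (RSB.cnt_mono D hYY').trans ?_
      refine le_trans ?_ (RSB.shatter_ge S m Y' hY')
      calc RSB.cnt D Y' ≤ (D.image (· ∩ Y')).card := by
            apply Finset.card_le_card
            intro e he
            obtain ⟨h1, h2⟩ := Finset.mem_filter.1 he
            exact Finset.mem_image.2 ⟨e, h1, Finset.inter_eq_left.2 h2⟩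
        _ ≤ _ := hDT Y'
        _ ≤ ((S.image (· ∩ Y')).image (· ∩ Z)).card := by
            apply Finset.card_le_card
            intro e he
            simp only [Finset.mem_image] at he ⊢
            obtain ⟨_, ⟨f, hf, rfl⟩, rfl⟩ := he
            exact ⟨_, ⟨f, hf, rfl⟩, Finset.inter_right_comm _ _ _⟩
        _ ≤ _ := Finset.card_image_le
    rw [hsh]
    refine RSB.down_bound D hD Z hDZ m (shatter S m) q _ t n s ht1 hq1 hp hst hst' hZc
      (hm.trans hn) hM ?_
    have h1 : 3 * (q:ℝ) * (s:ℝ) ^ 2 * t ≤ 3 * q * (s : ℝ) ^ 2 * Real.logb 2 (s : ℝ) :=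
      mul_le_mul_of_nonneg_left hfl (by positivity)
    linarith
  · have h0 : shatter S n = 0 := by
      unfold shatter
      rw [Finset.powersetCard_eq_empty.2 (by simpa using hX)]
      simp
    rw [h0]
    simp only [Nat.cast_zero]
    positivity
end

section
/- Let s ≥ 2 be a real number and let t = ⌊log₂ s⌋. Let m be an integer with m ≥ s³. For any finite set system S, if f_S(m) < s·m − 10·√m·s·√(log₂ s), then for all integers n ≥ m one has f_S(n) ≤ 3 · m^{2t} · n^{t+1−(2^{t+1}−t−2)/(s−1)}. -/
/-- number of tree edges touching `U` -/
def te (a : ℕ) (p : ℕ → ℕ) (U : Finset ℕ) : ℕ :=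
  ((Finset.range a).filter (fun k => k + 1 ∈ U ∨ p k ∈ U)).card

lemma te_succ (a : ℕ) (p : ℕ → ℕ) (x : ℕ) (U : Finset ℕ) :
    te (a + 1) (Function.update p a x) U
      = te a p U + (if a + 1 ∈ U ∨ x ∈ U then 1 else 0) := by
  unfold te
  rw [Finset.range_add_one, Finset.filter_insert]
  have h : (Finset.range a).filter (fun k => k + 1 ∈ U ∨ Function.update p a x k ∈ U)
      = (Finset.range a).filter (fun k => k + 1 ∈ U ∨ p k ∈ U) := by
    apply Finset.filter_congr
    intro k hk
    have : k ≠ a := by have := Finset.mem_range.1 hk; omega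
    rw [Function.update_of_ne this]
  rw [h, Function.update_self]
  split_ifs
  · rw [Finset.card_insert_of_notMem (by simp)]
  · rfl

/-- prefix invariant for the balanced caterpillar -/
def TGood (A B a q : ℕ) : Prop :=
  ∃ (p : ℕ → ℕ) (Q : Finset ℕ) (l : ℕ), (∀ k, p k ≤ k) ∧ Q ⊆ Finset.range (a + 1) ∧
    Q.card = q ∧ l ∈ Q ∧ ∀ U ⊆ Q,
      (l ∈ U → A * U.card + B * a ≤ B * te a p U + A * q) ∧
      (l ∉ U → A * U.card ≤ B * te a p U)

lemma TGood_zero (A B : ℕ) : TGood A B 0 1 := by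
  refine ⟨fun k => k, {0}, 0, fun k => le_rfl, by simp, by simp, by simp, ?_⟩
  intro U hU
  have hc := Finset.card_le_card hU
  simp at hc
  constructor
  · intro _
    nlinarith [Nat.zero_le (B * te 0 (fun k => k) U)]
  · intro h
    have : U = ∅ := by
      ext x
      simp only [Finset.notMem_empty, iff_false]
      intro hx
      have := hU hx
      simp at this
      exact h (this ▸ hx)
    simp [this]

lemma TGood_root {A B a q : ℕ} (h : TGood A B a q) : TGood A B (a + 1) q := by
  obtain ⟨p, Q, l, hp, hQ, hq, hl, hU⟩ := h
  have hla : l ≤ a := by have := Finset.mem_range.1 (hQ hl); omega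
  refine ⟨Function.update p a l, Q, l, ?_, ?_, hq, hl, ?_⟩
  · intro k
    by_cases hk : k = a
    · subst hk; simpa using hla
    · rw [Function.update_of_ne hk]; exact hp k
  · exact hQ.trans (Finset.range_subset_range.2 (by omega))
  · intro U hUQ
    obtain ⟨h1, h2⟩ := hU U hUQ
    rw [te_succ]
    have hn : a + 1 ∉ U := fun h => by have := Finset.mem_range.1 (hQ (hUQ h)); omega
    constructor
    · intro hlU
      have := h1 hlU
      simp only [hlU, or_true, if_true]
      nlinarith
    · intro hlU
      have := h2 hlU
      simp only [hlU, hn, or_self, if_false]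
      simpa using this

lemma TGood_path {A B a q : ℕ} (h : TGood A B a q) (h0 : A * q ≤ B * (a + 1)) (h1 : B * a ≤ A * q) :
    TGood A B (a + 1) (q + 1) := by
  obtain ⟨p, Q, l, hp, hQ, hq, hl, hU⟩ := h
  have hla : l ≤ a := by have := Finset.mem_range.1 (hQ hl); omega
  have hnQ : a + 1 ∉ Q := fun h => by have := Finset.mem_range.1 (hQ h); omega
  refine ⟨Function.update p a l, insert (a + 1) Q, a + 1, ?_, ?_, ?_, by simp, ?_⟩
  · intro k
    by_cases hk : k = a
    · subst hk; simpa using hla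
    · rw [Function.update_of_ne hk]; exact hp k
  · intro x hx
    rcases Finset.mem_insert.1 hx with rfl | hx
    · simp
    · have := Finset.mem_range.1 (hQ hx); simp; omega
  · rw [Finset.card_insert_of_notMem hnQ, hq]
  · intro U hUQ
    rw [te_succ]
    have hte : te a p (U.erase (a + 1)) = te a p U := by
      unfold te
      congr 1
      apply Finset.filter_congr
      intro k hk
      have hk := Finset.mem_range.1 hk
      have := hp k
      simp only [Finset.mem_erase]
      constructor
      · rintro (h | h)
        · exact Or.inl h.2
        · exact Or.inr h.2
      · rintro (h | h)
        · exact Or.inl ⟨by omega, h⟩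
        · exact Or.inr ⟨by omega, h⟩
    have hlne : l ≠ a + 1 := by omega
    obtain ⟨g1, g2⟩ := hU (U.erase (a + 1)) (by
      intro x hx
      obtain ⟨hx1, hx2⟩ := Finset.mem_erase.1 hx
      exact (Finset.mem_insert.1 (hUQ hx2)).resolve_left hx1)
    rw [hte] at g1 g2
    simp only [Finset.mem_erase, ne_eq, hlne, not_false_eq_true, true_and] at g1 g2
    constructor
    · intro hn
      have hc : U.card = (U.erase (a + 1)).card + 1 := (Finset.card_erase_add_one hn).symm
      simp only [hn, true_or, if_true]
      by_cases hlU : l ∈ U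
      · have := g1 hlU
        rw [hc]; nlinarith
      · have := g2 hlU
        rw [hc]; nlinarith
    · intro hn
      have hc : U.erase (a + 1) = U := Finset.erase_eq_of_notMem hn
      rw [hc] at g1 g2
      by_cases hlU : l ∈ U
      · have := g1 hlU
        simp only [hlU, or_true, if_true]
        nlinarith
      · have := g2 hlU
        simp only [hlU, hn, or_self, if_false]
        simpa using this

lemma TGood_mono {A B a a' q : ℕ} (h : TGood A B a q) (ha : a ≤ a') : TGood A B a' q := by
  induction a', ha using Nat.le_induction with
  | base => exact h
  | succ n _ ih => exact TGood_root ih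

lemma TGood_all {A B : ℕ} (hB : 1 ≤ B) (hAB : B ≤ A) (q : ℕ) (hq : 1 ≤ q) :
    ∃ a, TGood A B a q ∧ B * a ≤ A * q := by
  induction q, hq using Nat.le_induction with
  | base => exact ⟨0, TGood_zero A B, by simp⟩
  | succ q hq ih =>
    obtain ⟨a, ha, hle⟩ := ih
    have h1 : a ≤ A * q / B := by
      rw [Nat.le_div_iff_mul_le (by omega)]; linarith
    have h2 : B * (A * q / B) ≤ A * q := Nat.mul_div_le _ _
    have h3 : A * q < B * (A * q / B + 1) := Nat.lt_mul_div_succ _ (by omega)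
    refine ⟨A * q / B + 1, TGood_path (TGood_mono ha h1) h3.le h2, ?_⟩
    nlinarith

/-- balanced rooted trees -/
lemma tree_exists {A B : ℕ} (hB : 1 ≤ B) (hAB : B ≤ A) :
    ∃ (p : ℕ → ℕ) (Q : Finset ℕ), (∀ k, p k ≤ k) ∧ Q ⊆ Finset.range (A + 1) ∧ Q.card = B ∧
      ∀ U ⊆ Q, A * U.card ≤ B * te A p U := by
  obtain ⟨a, ha, hle⟩ := TGood_all hB hAB B hB
  have haA : a ≤ A := by
    by_contra h
    push Not at h
    nlinarith
  obtain ⟨p, Q, l, hp, hQ, hq, hl, hU⟩ := TGood_mono ha haA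
  refine ⟨p, Q, hp, hQ, hq, fun U hUQ => ?_⟩
  obtain ⟨g1, g2⟩ := hU U hUQ
  by_cases h : l ∈ U
  · have := g1 h
    nlinarith
  · exact g2 h

/-- counting tree embeddings -/
lemma emb_exists {X : Type*} [DecidableEq X] (K : Finset (Finset X)) (V : Finset X) (δ : ℕ)
    (hδ : ∀ v ∈ V, δ ≤ (V.filter (fun u => u ≠ v ∧ {u, v} ∈ K)).card)
    (p : ℕ → ℕ) (hp : ∀ k, p k ≤ k) (N a : ℕ) (haN : a ≤ N) :
    ∃ E : Finset (ℕ → X), V.card * (δ - N) ^ a ≤ E.card ∧ ∀ f ∈ E,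
      Set.InjOn f (Finset.range (a + 1) : Finset ℕ) ∧ (∀ k < a, {f (k + 1), f (p k)} ∈ K) ∧
      (∀ k, f k ∈ V) ∧ (∀ k, a < k → f k = f 0) := by
  classical
  induction a with
  | zero =>
    refine ⟨V.image (fun v _ => v), ?_, ?_⟩
    · rw [Finset.card_image_of_injective]
      · simp
      · intro x y h
        exact congrFun h 0
    · intro f hf
      obtain ⟨v, hv, rfl⟩ := Finset.mem_image.1 hf
      simp [hv]
  | succ a ih =>
    obtain ⟨E, hE, hf⟩ := ih (by omega)
    let M : (ℕ → X) → Finset X := fun f =>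
      (V.filter (fun u => u ≠ f (p a) ∧ {u, f (p a)} ∈ K)) \ (Finset.range (a + 1)).image f
    let G : (Σ _ : (ℕ → X), X) → (ℕ → X) := fun z => Function.update z.1 (a + 1) z.2
    refine ⟨(E.sigma M).image G, ?_, ?_⟩
    · rw [Finset.card_image_of_injOn]
      · rw [Finset.card_sigma, pow_succ, ← mul_assoc]
        calc V.card * (δ - N) ^ a * (δ - N) ≤ E.card * (δ - N) := Nat.mul_le_mul_right _ hE
          _ = ∑ _f ∈ E, (δ - N) := by simp
          _ ≤ _ := by
            apply Finset.sum_le_sum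
            intro f hfE
            have h1 := hδ (f (p a)) ((hf f hfE).2.2.1 _)
            have h2 := Finset.le_card_sdiff ((Finset.range (a + 1)).image f)
              (V.filter (fun u => u ≠ f (p a) ∧ {u, f (p a)} ∈ K))
            have h3 : ((Finset.range (a + 1)).image f).card ≤ a + 1 := by
              simpa using Finset.card_image_le (s := Finset.range (a + 1)) (f := f)
            change _ ≤ Finset.card (_ \ _)
            omega
      · rintro ⟨f, u⟩ hz ⟨g, v⟩ hz' h
        simp only [Finset.coe_sigma, Set.mem_sigma_iff, Finset.mem_coe] at hz hz'
        have huv : u = v := by simpa [G] using congrFun h (a + 1)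
        have hfg : ∀ k, k ≠ a + 1 → f k = g k := by
          intro k hk
          simpa [G, Function.update_of_ne hk] using congrFun h k
        have : f = g := by
          funext k
          by_cases hk : k = a + 1
          · rw [(hf f hz.1).2.2.2 k (by omega), (hf g hz'.1).2.2.2 k (by omega)]
            exact hfg 0 (by omega)
          · exact hfg k hk
        subst this huv
        rfl
    · intro g hg
      obtain ⟨⟨f, u⟩, hz, rfl⟩ := Finset.mem_image.1 hg
      obtain ⟨hfE, hu⟩ := Finset.mem_sigma.1 hz
      obtain ⟨i1, i2, i3, i4⟩ := hf f hfE
      simp only [M, Finset.mem_sdiff, Finset.mem_filter, Finset.mem_image, Finset.mem_range,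
        not_exists, not_and] at hu
      obtain ⟨⟨huV, hune, huK⟩, hun⟩ := hu
      have hne : ∀ k, k ≠ a + 1 → G ⟨f, u⟩ k = f k := fun k hk => Function.update_of_ne hk _ _
      have heq : G ⟨f, u⟩ (a + 1) = u := Function.update_self _ _ _
      refine ⟨?_, ?_, ?_, ?_⟩
      · intro x hx y hy hxy
        simp only [Finset.coe_range, Set.mem_Iio] at hx hy
        by_cases hx1 : x = a + 1 <;> by_cases hy1 : y = a + 1
        · omega
        · subst hx1
          rw [heq, hne y hy1] at hxy
          exact absurd hxy.symm (hun y (by omega))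
        · subst hy1
          rw [heq, hne x hx1] at hxy
          exact absurd hxy (hun x (by omega))
        · rw [hne x hx1, hne y hy1] at hxy
          exact i1 (by simp; omega) (by simp; omega) hxy
      · intro k hk
        have := hp k
        rw [hne (p k) (by omega)]
        by_cases hk1 : k = a
        · subst hk1; rw [heq]; exact huK
        · rw [hne _ (by omega)]; exact i2 k (by omega)
      · intro k
        by_cases hk : k = a + 1
        · subst hk; rw [heq]; exact huV
        · rw [hne k hk]; exact i3 k
      · intro k hk
        rw [hne k (by omega), hne 0 (by omega)]
        exact i4 k (by omega)

/-- number of 2-element members of `K` inside `Y` -/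
def ed {X : Type*} [DecidableEq X] (K : Finset (Finset X)) (Y : Finset X) : ℕ :=
  (K.filter (fun e => e ⊆ Y ∧ e.card = 2)).card

lemma grow_step {X : Type*} [DecidableEq X] (K : Finset (Finset X)) (A : ℕ)
    (p : ℕ → ℕ) (hp : ∀ k, p k ≤ k) (Q : Finset ℕ)
    (f : ℕ → X) (hinj : Set.InjOn f (Finset.range (A + 1) : Finset ℕ))
    (hadj : ∀ k < A, {f (k + 1), f (p k)} ∈ K)
    (Y : Finset X) :
    ed K Y + te A p (Q.filter (fun k => f k ∉ Y))
      ≤ ed K (Y ∪ (Finset.range (A + 1)).image f) := by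
  classical
  set U := Q.filter (fun k => f k ∉ Y) with hU
  have hi : ∀ k < A, ∀ k' < A, ({f (k + 1), f (p k)} : Finset X) = {f (k' + 1), f (p k')} → k ≤ k' := by
    intro k hk k' hk' h
    have h1 : f (k + 1) ∈ ({f (k' + 1), f (p k')} : Finset X) := h ▸ (by simp)
    have := hp k'
    simp only [Finset.mem_insert, Finset.mem_singleton] at h1
    rcases h1 with h1 | h1
    · have := hinj (by simp; omega) (by simp; omega) h1
      omega
    · have := hinj (by simp; omega) (by simp; omega) h1
      omega
  unfold ed te
  rw [← Finset.card_image_of_injOn (s := (Finset.range A).filter (fun k => k + 1 ∈ U ∨ p k ∈ U))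
    (f := fun k => ({f (k + 1), f (p k)} : Finset X)), ← Finset.card_union_of_disjoint]
  · apply Finset.card_le_card
    intro e he
    rcases Finset.mem_union.1 he with he | he
    · simp only [Finset.mem_filter] at he ⊢
      exact ⟨he.1, he.2.1.trans Finset.subset_union_left, he.2.2⟩
    · obtain ⟨k, hk, rfl⟩ := Finset.mem_image.1 he
      simp only [Finset.mem_filter, Finset.mem_range] at hk
      have hpk := hp k
      simp only [Finset.mem_filter]
      refine ⟨hadj k hk.1, ?_, ?_⟩
      · intro x hx
        simp only [Finset.mem_insert, Finset.mem_singleton] at hx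
        apply Finset.mem_union_right
        rcases hx with rfl | rfl
        · exact Finset.mem_image_of_mem _ (by simp; omega)
        · exact Finset.mem_image_of_mem _ (by simp; omega)
      · apply Finset.card_pair
        intro h
        have := hinj (by simp; omega) (by simp; omega) h
        omega
  · rw [Finset.disjoint_left]
    intro e he he'
    obtain ⟨k, hk, rfl⟩ := Finset.mem_image.1 he'
    simp only [Finset.mem_filter] at he hk
    rcases hk.2 with h | h
    · exact (Finset.mem_filter.1 h).2 (he.2.1 (by simp))
    · exact (Finset.mem_filter.1 h).2 (he.2.1 (by simp))
  · intro k hk k' hk' h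
    simp only [Finset.coe_filter, Finset.mem_range, Set.mem_ofPred_eq] at hk hk'
    exact le_antisymm (hi k hk.1 k' hk'.1 h) (hi k' hk'.1 k hk.1 h.symm)

lemma grow {X : Type*} [DecidableEq X] (K : Finset (Finset X)) (V : Finset X) (A B μ : ℕ)
    (p : ℕ → ℕ) (hp : ∀ k, p k ≤ k) (Q : Finset ℕ) (hQ : Q ⊆ Finset.range (A + 1))
    (hQB : Q.card = B) (hbal : ∀ U ⊆ Q, A * U.card ≤ B * te A p U)
    (E : Finset (ℕ → X)) (hE : ∀ f ∈ E,
      Set.InjOn f (Finset.range (A + 1) : Finset ℕ) ∧ (∀ k < A, {f (k + 1), f (p k)} ∈ K) ∧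
      (∀ k, f k ∈ V) ∧ (∀ k, A < k → f k = f 0))
    (hag : ∀ f ∈ E, ∀ g ∈ E, ∀ k ∈ Finset.range (A + 1) \ Q, f k = g k)
    (hne : E.Nonempty) (hcard : ∀ y, y + B ≤ μ → y ^ B < E.card) (hR : A + 1 - B ≤ μ) :
    ∃ Y ⊆ V, Y.card ≤ μ ∧ μ < Y.card + B ∧ A * Y.card ≤ B * ed K Y + A * (A + 1 - B) := by
  classical
  obtain ⟨f0, hf0⟩ := hne
  let C : Finset (Finset X) := V.powerset.filter (fun Y => Y.card ≤ μ ∧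
    A * Y.card ≤ B * ed K Y + A * (A + 1 - B) ∧ (Finset.range (A + 1) \ Q).image f0 ⊆ Y)
  have hRc : (Finset.range (A + 1) \ Q).card = A + 1 - B := by
    rw [Finset.card_sdiff_of_subset hQ, hQB, Finset.card_range]
  have hRi : ((Finset.range (A + 1) \ Q).image f0).card ≤ A + 1 - B := by
    rw [← hRc]; exact Finset.card_image_le
  have hC : C.Nonempty := by
    refine ⟨(Finset.range (A + 1) \ Q).image f0, ?_⟩
    simp only [C, Finset.mem_filter, Finset.mem_powerset]
    refine ⟨?_, hRi.trans hR, ?_, le_rfl⟩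
    · intro x hx
      obtain ⟨k, _, rfl⟩ := Finset.mem_image.1 hx
      exact (hE f0 hf0).2.2.1 k
    · have := Nat.mul_le_mul_left A hRi
      omega
  obtain ⟨Y, hY, hmax⟩ := Finset.exists_max_image C Finset.card hC
  simp only [C, Finset.mem_filter, Finset.mem_powerset] at hY
  obtain ⟨hYV, hYμ, hYe, hYR⟩ := hY
  refine ⟨Y, hYV, hYμ, ?_, hYe⟩
  by_contra hlt
  push Not at hlt
  -- find a copy not inside Y
  have : ∃ f ∈ E, ∃ k ∈ Q, f k ∉ Y := by
    by_contra hcon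
    push Not at hcon
    have h1 : E.card ≤ (Fintype.piFinset (fun _ : Q => Y)).card := by
      apply Finset.card_le_card_of_injOn (fun f => fun k : Q => f k)
      · intro f hf
        simp only [Finset.mem_coe, Fintype.mem_piFinset]
        intro k
        exact hcon f hf k k.2
      · intro f hf g hg h
        have hk : ∀ k < A + 1, f k = g k := by
          intro k hk
          by_cases hkQ : k ∈ Q
          · exact congrFun h ⟨k, hkQ⟩
          · exact hag f hf g hg k (by simp [hkQ]; omega)
        funext k
        by_cases hkA : k < A + 1
        · exact hk k hkA
        · rw [(hE f hf).2.2.2 k (by omega), (hE g hg).2.2.2 k (by omega)]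
          exact hk 0 (by omega)
    rw [Fintype.card_piFinset] at h1
    simp [hQB] at h1
    have := hcard Y.card hlt
    omega
  obtain ⟨f, hf, k0, hk0, hk0Y⟩ := this
  obtain ⟨i1, i2, i3, i4⟩ := hE f hf
  have hstep := grow_step K A p hp Q f i1 i2 Y
  set U := Q.filter (fun k => f k ∉ Y) with hU
  have hUQ : U ⊆ Q := Finset.filter_subset _ _
  have hb := hbal U hUQ
  have hset : Y ∪ (Finset.range (A + 1)).image f = Y ∪ U.image f := by
    ext x
    simp only [Finset.mem_union, Finset.mem_image]
    constructor
    · rintro (h | ⟨k, hk, rfl⟩)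
      · exact Or.inl h
      · by_cases hkY : f k ∈ Y
        · exact Or.inl hkY
        · right
          refine ⟨k, ?_, rfl⟩
          by_cases hkQ : k ∈ Q
          · exact Finset.mem_filter.2 ⟨hkQ, hkY⟩
          · exfalso
            have hkR : k ∈ Finset.range (A + 1) \ Q := Finset.mem_sdiff.2 ⟨hk, hkQ⟩
            apply hkY
            rw [hag f hf f0 hf0 k hkR]
            exact hYR (Finset.mem_image_of_mem _ hkR)
    · rintro (h | ⟨k, hk, rfl⟩)
      · exact Or.inl h
      · exact Or.inr ⟨k, hQ (hUQ hk), rfl⟩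
  have hUc : (U.image f).card = U.card := by
    apply Finset.card_image_of_injOn
    exact i1.mono (by exact_mod_cast hUQ.trans hQ)
  have hcardU : (Y ∪ U.image f).card = Y.card + U.card := by
    rw [Finset.card_union_of_disjoint, hUc]
    rw [Finset.disjoint_right]
    intro x hx
    obtain ⟨k, hk, rfl⟩ := Finset.mem_image.1 hx
    exact (Finset.mem_filter.1 hk).2
  have hUB : U.card ≤ B := hQB ▸ Finset.card_le_card hUQ
  have hUpos : 0 < U.card := Finset.card_pos.2 ⟨k0, Finset.mem_filter.2 ⟨hk0, hk0Y⟩⟩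
  rw [hset] at hstep
  have hmem : Y ∪ U.image f ∈ C := by
    simp only [C, Finset.mem_filter, Finset.mem_powerset]
    refine ⟨?_, by omega, ?_, hYR.trans Finset.subset_union_left⟩
    · apply Finset.union_subset hYV
      intro x hx
      obtain ⟨k, _, rfl⟩ := Finset.mem_image.1 hx
      exact i3 k
    · rw [hcardU]
      have := Nat.mul_le_mul_left B hstep
      nlinarith
  have := hmax _ hmem
  omega

/-- combinatorial core of the graph lemma -/
lemma graph_core {X : Type*} [DecidableEq X] (K : Finset (Finset X)) (V : Finset X)
    (A B μ m δ : ℕ) (hB : 1 ≤ B) (hAB : B ≤ A) (hVne : V.Nonempty)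
    (hδ : ∀ v ∈ V, δ ≤ (V.filter (fun u => u ≠ v ∧ {u, v} ∈ K)).card)
    (hμm : μ ≤ m) (hm : 1 ≤ m) (hR : A + 1 - B ≤ μ)
    (hcount : m ^ B * V.card ^ (A + 1 - B) ≤ V.card * (δ - A) ^ A) :
    ∃ Y ⊆ V, Y.card ≤ μ ∧ μ < Y.card + B ∧ A * Y.card ≤ B * ed K Y + A * (A + 1 - B) := by
  classical
  obtain ⟨p, Q, hp, hQ, hQB, hbal⟩ := tree_exists hB hAB
  obtain ⟨E, hEc, hE⟩ := emb_exists K V δ hδ p hp A A le_rfl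
  let R := Finset.range (A + 1) \ Q
  have hRc : R.card = A + 1 - B := by
    rw [Finset.card_sdiff_of_subset hQ, hQB, Finset.card_range]
  let T : Finset (R → X) := Fintype.piFinset (fun _ : R => V)
  have hT : T.card = V.card ^ (A + 1 - B) := by
    simp [T, Fintype.card_piFinset, hRc]
  have hTne : T.Nonempty := by
    rw [← Finset.card_pos, hT]
    exact pow_pos (Finset.card_pos.2 hVne) _
  obtain ⟨y, hy, hfib⟩ := Finset.exists_le_card_fiber_of_mul_le_card_of_maps_to
    (s := E) (t := T) (f := fun f => fun k : R => f k) (n := m ^ B)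
    (by
      intro f hf
      simp only [T, Fintype.mem_piFinset]
      intro k
      exact (hE f hf).2.2.1 k) hTne
    (by rw [hT, mul_comm]; exact hcount.trans hEc)
  refine grow K V A B μ p hp Q hQ hQB hbal
    (E.filter (fun f => (fun k : R => f k) = y)) (fun f hf => hE f (Finset.mem_filter.1 hf).1)
    ?_ ?_ ?_ hR
  · intro f hf g hg k hk
    have h1 := congrFun (Finset.mem_filter.1 hf).2 ⟨k, hk⟩
    have h2 := congrFun (Finset.mem_filter.1 hg).2 ⟨k, hk⟩
    exact h1.trans h2.symm
  · rw [← Finset.card_pos]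
    exact lt_of_lt_of_le (pow_pos hm _) hfib
  · intro z hz
    refine lt_of_lt_of_le (Nat.pow_lt_pow_left (by omega) (by omega)) hfib

set_option maxHeartbeats 1000000 in
lemma graph_lemma {X : Type*} [DecidableEq X] (K : Finset (Finset X)) (V : Finset X)
    (σ w : ℝ) (μ m : ℕ) (hσ : 2 ≤ σ) (hσm : σ ^ 2 ≤ m) (hw : w + 9 * √(m : ℝ) ≤ μ)
    (hμ : μ ≤ m) (hsq : √(m : ℝ) ≤ μ)
    (hY : ∀ Y ⊆ V, Y.card ≤ μ → (Y.card : ℝ) + ed K Y < σ * w) (hV : V.Nonempty) :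
    ∃ v ∈ V, ((V.filter (fun u => u ≠ v ∧ {u, v} ∈ K)).card : ℝ) ≤
      (2 * m : ℝ) ^ (1 / (σ - 1)) * (V.card : ℝ) ^ (1 - 1 / (σ - 1)) := by
  by_contra hcon
  push Not at hcon
  set r := √(m : ℝ) with hr
  have hm4 : (4 : ℝ) ≤ m := by nlinarith
  have hrr : r * r = m := Real.mul_self_sqrt (by linarith)
  have hr0 : 0 ≤ r := Real.sqrt_nonneg _
  have hσr : σ ≤ r := Real.le_sqrt_of_sq_le hσm
  set n := V.card with hn
  have hn1 : (1 : ℝ) ≤ n := by exact_mod_cast Finset.card_pos.2 hV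
  set ρ := σ - 1 with hρ
  have hρ1 : 1 ≤ ρ := by linarith
  have hρ0 : 0 < ρ := by linarith
  have hinv : 0 < 1 / ρ := by positivity
  have hinv1 : 1 / ρ ≤ 1 := by rw [div_le_one hρ0]; exact hρ1
  set d0 := (2 * m : ℝ) ^ (1 / ρ) * (n : ℝ) ^ (1 - 1 / ρ) with hd0
  clear_value d0
  have hΛ0 : (0 : ℝ) < 2 * m := by linarith
  have hn0 : (0 : ℝ) < n := by linarith
  have hd0n : d0 < n := by
    obtain ⟨v, hv⟩ := hV
    refine lt_of_lt_of_le (hcon v hv) ?_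
    exact_mod_cast Finset.card_filter_le _ _
  have hΛn : (2 * m : ℝ) < n := by
    by_contra h
    push Not at h
    have h1 : (n : ℝ) ^ (1 / ρ) ≤ (2 * m : ℝ) ^ (1 / ρ) :=
      Real.rpow_le_rpow hn0.le h hinv.le
    have h2 : (n : ℝ) ^ (1 / ρ) * (n : ℝ) ^ (1 - 1 / ρ) = n := by
      rw [← Real.rpow_add hn0]; simp
    have h3 : (n : ℝ) ^ (1 / ρ) * (n : ℝ) ^ (1 - 1 / ρ) ≤ d0 :=
      hd0 ▸ mul_le_mul_of_nonneg_right h1 (by positivity)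
    linarith
  have hd0Λ : (2 * m : ℝ) ≤ d0 := by
    have h1 : (2 * m : ℝ) ^ (1 - 1 / ρ) ≤ (n : ℝ) ^ (1 - 1 / ρ) :=
      Real.rpow_le_rpow hΛ0.le hΛn.le (by linarith)
    have h2 : (2 * m : ℝ) ^ (1 / ρ) * (2 * m : ℝ) ^ (1 - 1 / ρ) = 2 * m := by
      rw [← Real.rpow_add hΛ0]; simp
    have h3 : (2 * m : ℝ) ^ (1 / ρ) * (2 * m : ℝ) ^ (1 - 1 / ρ) ≤ d0 :=
      hd0 ▸ mul_le_mul_of_nonneg_left h1 (by positivity)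
    linarith
  have hd00 : 0 < d0 := by linarith
  set B := ⌊r / σ⌋₊ with hBdef
  set A := ⌊ρ * B⌋₊ with hAdef
  have hrσ : 1 ≤ r / σ := by rw [le_div_iff₀ (by linarith)]; linarith
  have hB1 : 1 ≤ B := Nat.one_le_floor_iff _ |>.2 hrσ
  have hB1' : (1 : ℝ) ≤ B := by exact_mod_cast hB1
  have hBr : σ * B ≤ r := by
    have := Nat.floor_le (show 0 ≤ r / σ by linarith)
    rw [le_div_iff₀ (by linarith)] at this
    linarith
  have hrB : r ≤ 2 * (σ * B) := by
    have := Nat.lt_floor_add_one (r / σ)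
    rw [div_lt_iff₀ (by linarith)] at this
    nlinarith
  have hAle : (A : ℝ) ≤ ρ * B := Nat.floor_le (by positivity)
  have hAge : ρ * B < A + 1 := Nat.lt_floor_add_one _
  have hAB : B ≤ A := Nat.le_floor (by nlinarith)
  have hAB' : (B : ℝ) ≤ A := by exact_mod_cast hAB
  have hAσ : (A : ℝ) ≤ σ * B := by nlinarith
  have hAr : (A : ℝ) ≤ r := by linarith
  have hAm : (A : ℝ) * A ≤ m := by nlinarith
  have hRle : A + 1 - B ≤ μ := by
    have : (A : ℝ) ≤ μ := by linarith
    have : A ≤ μ := by exact_mod_cast this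
    omega
  -- the counting inequality
  set δ := ⌊d0⌋₊ + 1 with hδdef
  have hδ : ∀ v ∈ V, δ ≤ (V.filter (fun u => u ≠ v ∧ {u, v} ∈ K)).card := by
    intro v hv
    have := hcon v hv
    exact (Nat.floor_lt hd00.le).2 this
  have hδd : d0 ≤ δ := by
    have := Nat.lt_floor_add_one d0
    rw [hδdef]; push_cast; linarith
  clear_value δ A B r ρ n
  have hA0 : (0 : ℝ) ≤ A := Nat.cast_nonneg _
  have hrm : r ≤ m := by rw [← hrr]; exact le_mul_of_one_le_left hr0 (by linarith)
  have hAd : (A : ℝ) ≤ d0 := by linarith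
  have hpow1 : d0 ^ A / 2 ≤ (d0 - A) ^ A := by
    have e1 : d0 - A = d0 * (1 + (-(A / d0))) := by field_simp; ring
    have hAd1 : A / d0 ≤ 1 := by rw [div_le_one hd00]; exact hAd
    have e2 := one_add_mul_le_pow (show (-2 : ℝ) ≤ -(A / d0) by linarith) A
    have e3 : (1 : ℝ) / 2 ≤ 1 + A * (-(A / d0)) := by
      have : (A : ℝ) * (A / d0) ≤ 1 / 2 := by
        rw [← mul_div_assoc, div_le_iff₀ hd00]; linarith
      linarith
    rw [e1, mul_pow d0]
    have : d0 ^ A * (1 / 2) ≤ d0 ^ A * (1 + (-(A / d0))) ^ A :=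
      mul_le_mul_of_nonneg_left (e3.trans e2) (by positivity)
    linarith
  have hpow2 : (2 * m : ℝ) ^ B * (n : ℝ) ^ (A - B) ≤ d0 ^ A := by
    have hx : 0 ≤ (B : ℝ) - A / ρ := by
      have : A / ρ ≤ (B : ℝ) := by rw [div_le_iff₀ hρ0]; linarith
      linarith
    have e1 : d0 ^ A = (2 * m : ℝ) ^ ((A : ℝ) / ρ) * (n : ℝ) ^ ((A : ℝ) - A / ρ) := by
      rw [hd0, mul_pow, ← Real.rpow_mul_natCast hΛ0.le, ← Real.rpow_mul_natCast hn0.le]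
      congr 2 <;> ring
    have e2 : (2 * m : ℝ) ^ B = (2 * m : ℝ) ^ ((A : ℝ) / ρ) * (2 * m : ℝ) ^ ((B : ℝ) - A / ρ) := by
      rw [← Real.rpow_add hΛ0, ← Real.rpow_natCast]; congr 1; ring
    have e3 : (n : ℝ) ^ ((B : ℝ) - A / ρ) * (n : ℝ) ^ (A - B) = (n : ℝ) ^ ((A : ℝ) - A / ρ) := by
      rw [← Real.rpow_natCast, ← Real.rpow_add hn0, Nat.cast_sub hAB]; congr 1; ring
    have e4 : (2 * m : ℝ) ^ ((B : ℝ) - A / ρ) ≤ (n : ℝ) ^ ((B : ℝ) - A / ρ) :=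
      Real.rpow_le_rpow hΛ0.le hΛn.le hx
    rw [e1, e2, ← e3, mul_assoc]
    gcongr
  have hcount : m ^ B * n ^ (A + 1 - B) ≤ n * (δ - A) ^ A := by
    have h1 : d0 - A ≤ ((δ - A : ℕ) : ℝ) := by
      have : (δ : ℝ) ≤ ((δ - A : ℕ) : ℝ) + A := by
        have : δ ≤ (δ - A) + A := by omega
        exact_mod_cast this
      linarith
    have h2 : (d0 - A) ^ A ≤ ((δ - A : ℕ) : ℝ) ^ A := pow_le_pow_left₀ (by linarith) h1 A
    have h3 : (2 : ℝ) ≤ 2 ^ B := by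
      calc (2 : ℝ) = 2 ^ 1 := by norm_num
        _ ≤ 2 ^ B := pow_le_pow_right₀ (by norm_num) hB1
    have h4 : (m : ℝ) ^ B * (n : ℝ) ^ (A - B) ≤ ((δ - A : ℕ) : ℝ) ^ A := by
      have : 2 * ((m : ℝ) ^ B * (n : ℝ) ^ (A - B)) ≤ (2 * m : ℝ) ^ B * (n : ℝ) ^ (A - B) := by
        rw [mul_pow, ← mul_assoc]
        gcongr
      linarith
    have h5 : A + 1 - B = (A - B) + 1 := by omega
    have h6 : (m : ℝ) ^ B * (n : ℝ) ^ (A + 1 - B) ≤ (n : ℝ) * ((δ - A : ℕ) : ℝ) ^ A := by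
      rw [h5, pow_succ]
      nlinarith
    exact_mod_cast h6
  have hm1 : 1 ≤ m := by
    have : (1 : ℝ) ≤ m := by linarith
    exact_mod_cast this
  obtain ⟨Y, hYV, hYμ, hYB, hYe⟩ := graph_core K V A B μ m δ hB1 hAB hV hδ hμ hm1 hRle (hn ▸ hcount)
  have hlt := hY Y hYV hYμ
  have hYm : (Y.card : ℝ) ≤ m := by exact_mod_cast hYμ.trans hμ
  have hYB' : (μ : ℝ) ≤ Y.card + B := by exact_mod_cast hYB.le
  have hYe' : (A : ℝ) * Y.card ≤ B * ed K Y + A * A := by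
    have : A * Y.card ≤ B * ed K Y + A * A :=
      hYe.trans (Nat.add_le_add_left (Nat.mul_le_mul_left A (by omega)) _)
    exact_mod_cast this
  set y := (Y.card : ℝ)
  set e := (ed K Y : ℝ)
  have hy0 : 0 ≤ y := Nat.cast_nonneg _
  set b := (B : ℝ)
  set a := (A : ℝ)
  have k1 : b * (y + e) < b * (σ * w) := mul_lt_mul_of_pos_left hlt (by linarith)
  have k2 : σ * b * y - m - a * a ≤ b * (y + e) := by
    have : (σ * b - 1) * y ≤ (a + b) * y := by
      apply mul_le_mul_of_nonneg_right _ hy0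
      rw [hρ] at hAge; nlinarith
    nlinarith
  have hσb : 0 ≤ σ * b := by nlinarith
  have k3 : σ * b * (μ - b) ≤ σ * b * y := mul_le_mul_of_nonneg_left (by linarith) hσb
  have k4 : σ * b * w ≤ σ * b * (μ - 9 * r) := mul_le_mul_of_nonneg_left (by linarith) hσb
  have k5 : a * a ≤ σ * b * r := mul_le_mul hAσ hAr hA0 hσb
  have k6 : (m : ℝ) ≤ 2 * (σ * b) * r := by rw [← hrr]; exact mul_le_mul_of_nonneg_right hrB hr0
  have k7 : σ * b * b ≤ σ * b * r := mul_le_mul_of_nonneg_left (by nlinarith) hσb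
  have k8 : 0 < σ * b * r := by
    apply mul_pos <;> nlinarith
  linarith

def IsDown {X : Type*} (K : Finset (Finset X)) : Prop := ∀ e ∈ K, ∀ e' ⊆ e, e' ∈ K

def cnt {X : Type*} [DecidableEq X] (K : Finset (Finset X)) (Y : Finset X) : ℕ :=
  (K.filter (· ⊆ Y)).card

/-- the link of a vertex -/
def lk {X : Type*} [DecidableEq X] (K : Finset (Finset X)) (v : X) : Finset (Finset X) :=
  (K.filter (fun e => v ∈ e)).image (fun e => e.erase v)

section
variable {X : Type*} [DecidableEq X]

lemma mem_lk {K : Finset (Finset X)} {v : X} {e : Finset X} :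
    e ∈ lk K v ↔ v ∉ e ∧ insert v e ∈ K := by
  unfold lk
  simp only [Finset.mem_image, Finset.mem_filter]
  constructor
  · rintro ⟨f, ⟨hf, hv⟩, rfl⟩
    refine ⟨Finset.notMem_erase _ _, ?_⟩
    rw [Finset.insert_erase hv]; exact hf
  · rintro ⟨hv, he⟩
    exact ⟨insert v e, ⟨he, Finset.mem_insert_self _ _⟩, Finset.erase_insert hv⟩

lemma lk_card (K : Finset (Finset X)) (v : X) :
    (lk K v).card = (K.filter (fun e => v ∈ e)).card := by
  unfold lk
  apply Finset.card_image_of_injOn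
  intro e he f hf h
  simp only [Finset.coe_filter, Set.mem_ofPred_eq] at he hf
  simp only at h
  rw [← Finset.insert_erase he.2, h, Finset.insert_erase hf.2]

lemma lk_down {K : Finset (Finset X)} (hK : IsDown K) (v : X) : IsDown (lk K v) := by
  intro e he e' hee
  rw [mem_lk] at he ⊢
  exact ⟨fun h => he.1 (hee h), hK _ he.2 _ (Finset.insert_subset_insert _ hee)⟩

lemma cnt_lk {K : Finset (Finset X)} (hK : IsDown K) (v : X) (Y : Finset X) :
    2 * cnt (lk K v) Y ≤ cnt K (insert v Y) := by
  unfold cnt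
  set L := (lk K v).filter (· ⊆ Y) with hL
  have hmem : ∀ e ∈ L, v ∉ e ∧ insert v e ∈ K ∧ e ⊆ Y := by
    intro e he
    obtain ⟨h1, h2⟩ := Finset.mem_filter.1 he
    exact ⟨(mem_lk.1 h1).1, (mem_lk.1 h1).2, h2⟩
  have h1 : (L.image (insert v)).card = L.card := by
    apply Finset.card_image_of_injOn
    intro e he f hf h
    rw [← Finset.erase_insert (hmem e he).1, ← Finset.erase_insert (hmem f hf).1, h]
  have h2 : Disjoint L (L.image (insert v)) := by
    rw [Finset.disjoint_right]
    intro e he he'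
    obtain ⟨f, hf, rfl⟩ := Finset.mem_image.1 he
    exact (hmem _ he').1 (Finset.mem_insert_self _ _)
  calc 2 * L.card = (L ∪ L.image (insert v)).card := by
        rw [Finset.card_union_of_disjoint h2, h1]; ring
    _ ≤ _ := by
      apply Finset.card_le_card
      intro e he
      rw [Finset.mem_filter]
      rcases Finset.mem_union.1 he with he | he
      · obtain ⟨_, h4, h5⟩ := hmem e he
        exact ⟨hK _ h4 _ (Finset.subset_insert _ _), h5.trans (Finset.subset_insert _ _)⟩
      · obtain ⟨f, hf, rfl⟩ := Finset.mem_image.1 he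
        obtain ⟨_, h4, h5⟩ := hmem f hf
        exact ⟨h4, Finset.insert_subset_insert _ h5⟩

lemma lk_sub {K : Finset (Finset X)} (hK : IsDown K) (V : Finset X) (hV : ∀ e ∈ K, e ⊆ V) (v : X) :
    ∀ e ∈ lk K v, e ⊆ V.filter (fun u => u ≠ v ∧ {u, v} ∈ K) := by
  intro e he u hu
  obtain ⟨h1, h2⟩ := mem_lk.1 he
  rw [Finset.mem_filter]
  refine ⟨hV _ h2 (Finset.mem_insert_of_mem hu), fun h => h1 (h ▸ hu), hK _ h2 _ ?_⟩
  intro x hx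
  simp only [Finset.mem_insert, Finset.mem_singleton] at hx
  rcases hx with rfl | rfl
  · exact Finset.mem_insert_of_mem hu
  · exact Finset.mem_insert_self _ _

lemma cnt_ge {K : Finset (Finset X)} (h0 : ∅ ∈ K) (Y : Finset X)
    (hY : ∀ v ∈ Y, {v} ∈ K) : 1 + Y.card + ed K Y ≤ cnt K Y := by
  unfold cnt ed
  have e1 : (Y.image (fun v => ({v} : Finset X))).card = Y.card :=
    Finset.card_image_of_injective _ Finset.singleton_injective
  have d1 : Disjoint ({∅} : Finset (Finset X)) (Y.image (fun v => ({v} : Finset X))) := by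
    rw [Finset.disjoint_left]
    intro e he he'
    simp at he he'
    subst he
    obtain ⟨a, _, h⟩ := he'
    exact absurd h (Finset.singleton_ne_empty a)
  have d2 : Disjoint (({∅} : Finset (Finset X)) ∪ (Y.image (fun v => ({v} : Finset X))))
      (K.filter (fun e => e ⊆ Y ∧ e.card = 2)) := by
    rw [Finset.disjoint_left]
    intro e he he'
    have h2 := (Finset.mem_filter.1 he').2.2
    rcases Finset.mem_union.1 he with h | h
    · simp at h; subst h; simp at h2
    · obtain ⟨a, _, rfl⟩ := Finset.mem_image.1 h
      simp at h2
  have : 1 + Y.card + (K.filter (fun e => e ⊆ Y ∧ e.card = 2)).card =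
      ((({∅} : Finset (Finset X)) ∪ (Y.image (fun v => ({v} : Finset X)))) ∪
      (K.filter (fun e => e ⊆ Y ∧ e.card = 2))).card := by
    rw [Finset.card_union_of_disjoint d2, Finset.card_union_of_disjoint d1, e1, Finset.card_singleton]
  rw [this]
  apply Finset.card_le_card
  intro e he
  rw [Finset.mem_filter]
  rcases Finset.mem_union.1 he with h | h
  · rcases Finset.mem_union.1 h with h | h
    · simp at h; subst h; exact ⟨h0, Finset.empty_subset _⟩
    · obtain ⟨a, ha, rfl⟩ := Finset.mem_image.1 h
      exact ⟨hY a ha, by simpa using ha⟩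
  · obtain ⟨h1, h2, _⟩ := Finset.mem_filter.1 h
    exact ⟨h1, h2⟩

/-- degeneracy peeling -/
lemma peel (K : Finset (Finset X)) (c : ℝ) (V : Finset X)
    (h : ∀ V' ⊆ V, V'.Nonempty → ∃ v ∈ V', ((lk (K.filter (· ⊆ V')) v).card : ℝ) ≤ c) :
    (cnt K V : ℝ) ≤ 1 + V.card * c := by
  induction hn : V.card generalizing V with
  | zero =>
    have : V = ∅ := Finset.card_eq_zero.1 hn
    subst this
    have : cnt K ∅ ≤ 1 := by
      unfold cnt
      rw [Finset.card_le_one]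
      intro a ha b hb
      simp at ha hb
      rw [ha.2, hb.2]
    simpa using (show (cnt K ∅ : ℝ) ≤ 1 by exact_mod_cast this)
  | succ n ih =>
    obtain ⟨v, hv, hc⟩ := h V le_rfl (Finset.card_pos.1 (by omega))
    have h1 := ih (V.erase v) (fun V' hV' => h V' (hV'.trans (Finset.erase_subset _ _)))
      (by rw [Finset.card_erase_of_mem hv]; omega)
    have h2 : cnt K V = cnt K (V.erase v) + (lk (K.filter (· ⊆ V)) v).card := by
      rw [lk_card]
      unfold cnt
      rw [← Finset.card_filter_add_card_filter_not (s := K.filter (· ⊆ V)) (fun e => v ∈ e), add_comm]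
      congr 2
      ext e
      simp only [Finset.mem_filter, Finset.subset_erase]
      tauto
    rw [h2]
    push_cast
    linarith

lemma filter_down {K : Finset (Finset X)} (hK : IsDown K) (V : Finset X) :
    IsDown (K.filter (· ⊆ V)) := by
  intro e he e' hee
  rw [Finset.mem_filter] at he ⊢
  exact ⟨hK _ he.1 _ hee, hee.trans he.2⟩

lemma cnt_filter_le (K : Finset (Finset X)) (V Y : Finset X) :
    cnt (K.filter (· ⊆ V)) Y ≤ cnt K Y := by
  unfold cnt
  exact Finset.card_le_card (Finset.filter_subset_filter _ (Finset.filter_subset _ _))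

lemma cnt_eq_card {K : Finset (Finset X)} {V : Finset X} (hV : ∀ e ∈ K, e ⊆ V) :
    cnt K V = K.card := by
  unfold cnt
  rw [Finset.filter_true_of_mem hV]

noncomputable def bet : ℕ → ℝ → ℝ
  | 0, _ => 1
  | τ + 1, σ => 1 + (1 - 1 / (σ - 1)) * bet τ (σ / 2)

lemma two_le_of {τ : ℕ} {σ : ℝ} (h : (2 : ℝ) ^ (τ + 1) ≤ σ) : 2 ≤ σ := by
  have : (1 : ℝ) ≤ 2 ^ τ := one_le_pow₀ (by norm_num)
  rw [pow_succ] at h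
  linarith

lemma theta_bounds {σ : ℝ} (h : 2 ≤ σ) : 0 ≤ 1 - 1 / (σ - 1) ∧ 1 - 1 / (σ - 1) ≤ 1 := by
  have h1 : 1 / (σ - 1) ≤ 1 := by rw [div_le_one (by linarith)]; linarith
  have h2 : 0 < 1 / (σ - 1) := by apply div_pos <;> linarith
  constructor <;> linarith

lemma bet_bounds (τ : ℕ) : ∀ σ : ℝ, (2 : ℝ) ^ τ ≤ σ → 0 ≤ bet τ σ ∧ bet τ σ ≤ τ + 1 := by
  induction τ with
  | zero => intro σ _; simp [bet]
  | succ τ ih =>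
    intro σ h
    have h2 := two_le_of h
    obtain ⟨a1, a2⟩ := theta_bounds h2
    obtain ⟨b1, b2⟩ := ih (σ / 2) (by rw [pow_succ] at h; linarith)
    simp only [bet]
    push_cast
    constructor
    · have := mul_nonneg a1 b1; linarith
    · have := mul_le_mul a2 b2 b1 zero_le_one; linarith

lemma bet_eq (τ : ℕ) : ∀ σ : ℝ, (2 : ℝ) ^ τ ≤ σ →
    bet τ σ = τ + 1 - (2 ^ (τ + 1) - τ - 2) / (σ - 1) := by
  induction τ with
  | zero => intro σ _; simp [bet]
  | succ τ ih =>
    intro σ h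
    have h2 := two_le_of h
    have hs1 : σ - 1 ≠ 0 := by intro h; linarith
    simp only [bet]
    rw [ih (σ / 2) (by rw [pow_succ] at h; linarith)]
    push_cast
    rcases eq_or_lt_of_le h2 with h3 | h3
    · subst h3
      have : τ = 0 := by
        by_contra hne
        have : (2 : ℝ) ^ 2 ≤ 2 ^ (τ + 1) := pow_le_pow_right₀ (by norm_num) (by omega)
        linarith
      subst this
      norm_num
    · have hs2 : σ - 2 ≠ 0 := by intro h; linarith
      have hs3 : σ / 2 - 1 ≠ 0 := by intro h; linarith
      rw [show σ / 2 - 1 = (σ - 2) / 2 by ring]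
      field_simp
      ring

lemma main_rec (m : ℕ) (w : ℝ) (hw : 0 ≤ w) (hm : 1 ≤ m) (τ : ℕ) :
    ∀ (σ : ℝ) (μ : ℕ) (K : Finset (Finset X)) (V : Finset X) (x : ℝ),
      (2 : ℝ) ^ τ ≤ σ → σ < 2 ^ (τ + 1) → σ ^ 2 ≤ m → μ ≤ m → w + 9 * √(m : ℝ) + τ ≤ μ →
      IsDown K → (∀ e ∈ K, e ⊆ V) → (∀ Y : Finset X, Y.card ≤ μ → (cnt K Y : ℝ) < σ * w) →
      1 ≤ x → (V.card : ℝ) ≤ x →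
      (K.card : ℝ) ≤ (m + τ) * ((2 * m : ℝ) ^ ((τ : ℝ) + 1 - bet τ σ) * x ^ bet τ σ) := by
  have hmr : (1 : ℝ) ≤ m := by exact_mod_cast hm
  have hr1 : 1 ≤ √(m : ℝ) := Real.one_le_sqrt.2 hmr
  -- the link satisfies the hypothesis
  have hlink : ∀ (σ : ℝ) (μ : ℕ) (K : Finset (Finset X)) (v : X), 1 ≤ μ → IsDown K →
      (∀ Y : Finset X, Y.card ≤ μ → (cnt K Y : ℝ) < σ * w) →
      ∀ Y : Finset X, Y.card ≤ μ - 1 → (cnt (lk K v) Y : ℝ) < σ / 2 * w := by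
    intro σ μ K v hμ hK hc Y hY
    have h1 := hc (insert v Y) ((Finset.card_insert_le _ _).trans (by omega))
    have h2 : (2 : ℝ) * cnt (lk K v) Y ≤ cnt K (insert v Y) := by exact_mod_cast cnt_lk hK v Y
    linarith
  induction τ with
  | zero =>
    intro σ μ K V x hσ1 hσ2 hσm hμm hwμ hK hV hc hx hVx
    have hwμ' : w + 9 * √(m : ℝ) ≤ μ := by simpa using hwμ
    have hμ1 : (1 : ℝ) < μ := by linarith
    have hμ1' : 1 < μ := by exact_mod_cast hμ1
    have hμmr : (μ : ℝ) ≤ m := by exact_mod_cast hμm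
    have key := peel K (m - 1) V (by
      intro V' hV' hne
      obtain ⟨v, hv⟩ := hne
      refine ⟨v, hv, ?_⟩
      set K' := K.filter (· ⊆ V') with hK'
      have hK'd : IsDown K' := filter_down hK V'
      have hc' : ∀ Y : Finset X, Y.card ≤ μ → (cnt K' Y : ℝ) < σ * w := fun Y hY =>
        lt_of_le_of_lt (by exact_mod_cast cnt_filter_le K V' Y) (hc Y hY)
      have hl := hlink σ μ K' v hμ1'.le hK'd hc'
      have hld := lk_down hK'd v
      have hls := lk_sub hK'd V' (fun e he => (Finset.mem_filter.1 he).2) v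
      set N := V'.filter (fun u => u ≠ v ∧ {u, v} ∈ K') with hN
      have hσw : σ / 2 * w ≤ w := by
        norm_num at hσ2
        nlinarith
      by_cases hle : N.card ≤ μ - 1
      · have := hl N hle
        rw [cnt_eq_card hls] at this
        linarith
      · exfalso
        obtain ⟨Y, hYN, hYc⟩ := Finset.exists_subset_card_eq (show μ - 1 ≤ N.card by omega)
        have h1 := hl Y hYc.le
        have hsing : ∀ u ∈ Y, {u} ∈ lk K' v := by
          intro u hu
          obtain ⟨_, h2, h3⟩ := Finset.mem_filter.1 (hYN hu)
          rw [mem_lk]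
          exact ⟨by simpa using h2.symm, by rwa [Finset.pair_comm] at h3⟩
        have h0 : ∅ ∈ lk K' v := by
          have : Y.Nonempty := Finset.card_pos.1 (by omega)
          obtain ⟨u, hu⟩ := this
          exact hld _ (hsing u hu) _ (Finset.empty_subset _)
        have h2 := cnt_ge h0 Y hsing
        have h3 : μ ≤ cnt (lk K' v) Y := by omega
        have h4 : (μ : ℝ) ≤ cnt (lk K' v) Y := by exact_mod_cast h3
        linarith)
    rw [cnt_eq_card hV] at key
    simp only [bet]
    norm_num
    nlinarith
  | succ τ ih =>
    intro σ μ K V x hσ1 hσ2 hσm hμm hwμ hK hV hc hx hVx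
    push_cast at hwμ
    have hτ0 : (0 : ℝ) ≤ τ := Nat.cast_nonneg _
    have hσ := two_le_of hσ1
    have hμ1 : (1 : ℝ) < μ := by linarith
    have hμ1' : 1 < μ := by exact_mod_cast hμ1
    obtain ⟨t1, t2⟩ := theta_bounds hσ
    set θ := 1 - 1 / (σ - 1) with hθ
    have hσ1' : (2 : ℝ) ^ τ ≤ σ / 2 := by rw [pow_succ] at hσ1; linarith
    obtain ⟨b1, b2⟩ := bet_bounds τ (σ / 2) hσ1'
    set β := bet τ (σ / 2) with hβ
    have hΛ1 : (1 : ℝ) ≤ 2 * m := by linarith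
    have hΛ0 : (0 : ℝ) < 2 * m := by linarith
    have hx0 : 0 < x := by linarith
    set x' := (2 * m : ℝ) ^ (1 - θ) * x ^ θ with hx'
    have hx'1 : 1 ≤ x' := one_le_mul_of_one_le_of_one_le
      (Real.one_le_rpow hΛ1 (by linarith)) (Real.one_le_rpow hx t1)
    set c := (m + τ : ℝ) * ((2 * m : ℝ) ^ ((τ : ℝ) + 1 - β) * x' ^ β) with hcdef
    have hc0 : 0 ≤ c := by positivity
    have key := peel K c V (by
      intro V' hV' hne
      set K' := K.filter (· ⊆ V') with hK'
      have hK'd : IsDown K' := filter_down hK V'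
      have hc' : ∀ Y : Finset X, Y.card ≤ μ → (cnt K' Y : ℝ) < σ * w := fun Y hY =>
        lt_of_le_of_lt (by exact_mod_cast cnt_filter_le K V' Y) (hc Y hY)
      by_cases hall : ∀ v ∈ V', {v} ∈ K'
      · have h0 : ∅ ∈ K' := by
          obtain ⟨v, hv⟩ := hne
          exact hK'd _ (hall v hv) _ (Finset.empty_subset _)
        obtain ⟨v, hv, hdeg⟩ := graph_lemma K' V' σ w μ m hσ hσm (by linarith) hμm (by linarith)
          (by
            intro Y hYV hYμ
            have h1 := cnt_ge h0 Y (fun v hv => hall v (hYV hv))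
            have h2 := hc' Y hYμ
            have h3 : (1 : ℝ) + Y.card + ed K' Y ≤ cnt K' Y := by exact_mod_cast h1
            linarith) hne
        refine ⟨v, hv, ?_⟩
        have hls := lk_sub hK'd V' (fun e he => (Finset.mem_filter.1 he).2) v
        refine ih (σ / 2) (μ - 1) (lk K' v) _ x' hσ1' ?_ ?_ (by omega) ?_ (lk_down hK'd v) hls
          (hlink σ μ K' v hμ1'.le hK'd hc') hx'1 ?_
        · rw [pow_succ] at hσ2; linarith
        · nlinarith
        · rw [Nat.cast_sub hμ1'.le]; push_cast; linarith
        · refine hdeg.trans ?_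
          rw [hx', show 1 - θ = 1 / (σ - 1) by rw [hθ]; ring]
          have hV'x : (V'.card : ℝ) ≤ x := le_trans (by exact_mod_cast Finset.card_le_card hV') hVx
          gcongr
      · push Not at hall
        obtain ⟨v, hv, hvK⟩ := hall
        refine ⟨v, hv, ?_⟩
        have : lk K' v = ∅ := by
          apply Finset.eq_empty_of_forall_notMem
          intro e he
          obtain ⟨_, h2⟩ := mem_lk.1 he
          exact hvK (hK'd _ h2 _ (by simp))
        rw [this]
        simpa using hc0)
    rw [cnt_eq_card hV] at key
    simp only [bet]
    rw [← hβ, ← hθ]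
    push_cast
    set y := (2 * m : ℝ) ^ ((τ : ℝ) + 1 + 1 - (1 + θ * β)) * x ^ (1 + θ * β) with hy
    have hθβ : θ * β ≤ τ + 1 := by
      have := mul_le_mul t2 b2 b1 zero_le_one; linarith
    have hθβ0 : 0 ≤ θ * β := mul_nonneg t1 b1
    have hy1 : 1 ≤ y := one_le_mul_of_one_le_of_one_le
      (Real.one_le_rpow hΛ1 (by linarith)) (Real.one_le_rpow hx (by linarith))
    have hxc : x * c = (m + τ) * y := by
      have e1 : x' ^ β = (2 * m : ℝ) ^ ((1 - θ) * β) * x ^ (θ * β) := by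
        rw [hx', Real.mul_rpow (by positivity) (by positivity), ← Real.rpow_mul hΛ0.le,
          ← Real.rpow_mul hx0.le]
      have e2 : (2 * m : ℝ) ^ ((τ : ℝ) + 1 - β) * (2 * m : ℝ) ^ ((1 - θ) * β)
          = (2 * m : ℝ) ^ ((τ : ℝ) + 1 + 1 - (1 + θ * β)) := by
        rw [← Real.rpow_add hΛ0]; congr 1; ring
      have e3 : x ^ (1 + θ * β) = x * x ^ (θ * β) := by
        rw [Real.rpow_add hx0, Real.rpow_one]
      rw [hcdef, hy, e1, e3, ← e2]
      ring
    have : (V.card : ℝ) * c ≤ x * c := mul_le_mul_of_nonneg_right hVx hc0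
    linarith
end

section
variable {X : Type*} [DecidableEq X]

lemma trace_compression_le (a : X) (D : Finset (Finset X)) (Y : Finset X) :
    ((Down.compression a D).image (· ∩ Y)).card ≤ (D.image (· ∩ Y)).card := by
  by_cases ha : a ∈ Y
  · rw [← Down.card_compression a (D.image (· ∩ Y))]
    apply Finset.card_le_card
    intro g hg
    obtain ⟨f, hf, rfl⟩ := Finset.mem_image.1 hg
    rw [Down.mem_compression] at hf ⊢
    rcases hf with ⟨h1, h2⟩ | ⟨h1, h2⟩
    · left
      refine ⟨Finset.mem_image_of_mem _ h1, Finset.mem_image.2 ⟨_, h2, ?_⟩⟩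
      ext x; simp
    · have haf : a ∉ f := fun h => h1 (by rwa [Finset.insert_eq_of_mem h] at h2)
      by_cases hg : f ∩ Y ∈ D.image (· ∩ Y)
      · left
        refine ⟨hg, ?_⟩
        rwa [Finset.erase_eq_of_notMem (by simp [haf])]
      · right
        refine ⟨hg, Finset.mem_image.2 ⟨_, h2, ?_⟩⟩
        rw [Finset.insert_inter_of_mem ha]
  · apply Finset.card_le_card
    intro g hg
    obtain ⟨f, hf, rfl⟩ := Finset.mem_image.1 hg
    rw [Down.mem_compression] at hf
    rcases hf with ⟨h1, _⟩ | ⟨_, h2⟩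
    · exact Finset.mem_image_of_mem _ h1
    · refine Finset.mem_image.2 ⟨_, h2, ?_⟩
      rw [Finset.insert_inter_of_notMem ha]

lemma sum_compression_lt (a : X) (D : Finset (Finset X)) (e : Finset X) (he : e ∈ D) (hae : a ∈ e)
    (hne : e.erase a ∉ D) :
    ∑ f ∈ Down.compression a D, f.card < ∑ f ∈ D, f.card := by
  classical
  -- bijection `D → compression`
  let φ : Finset X → Finset X := fun f => if f.erase a ∈ D then f else f.erase a
  have hinj : Set.InjOn φ D := by
    intro f hf g hg h
    simp only [φ] at h
    split_ifs at h with h1 h2 h2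
    · exact h
    · exact absurd (h ▸ hf) h2
    · exact absurd (h ▸ hg) h1
    · have hf' : a ∈ f := by
        by_contra hh; rw [Finset.erase_eq_of_notMem hh] at h1; exact h1 hf
      have hg' : a ∈ g := by
        by_contra hh; rw [Finset.erase_eq_of_notMem hh] at h2; exact h2 hg
      rw [← Finset.insert_erase hf', h, Finset.insert_erase hg']
  have himg : D.image φ = Down.compression a D := by
    apply Finset.eq_of_subset_of_card_le
    · intro g hg
      obtain ⟨f, hf, rfl⟩ := Finset.mem_image.1 hg
      simp only [φ]
      rw [Down.mem_compression]
      split_ifs with h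
      · exact Or.inl ⟨hf, h⟩
      · right
        have hf' : a ∈ f := by
          by_contra hh; rw [Finset.erase_eq_of_notMem hh] at h; exact h hf
        exact ⟨h, by rwa [Finset.insert_erase hf']⟩
    · rw [Down.card_compression, Finset.card_image_of_injOn hinj]
  rw [← himg, Finset.sum_image hinj]
  apply Finset.sum_lt_sum
  · intro f _
    simp only [φ]
    split_ifs
    · exact le_rfl
    · exact Finset.card_le_card (Finset.erase_subset _ _)
  · refine ⟨e, he, ?_⟩
    simp only [φ, if_neg hne]
    exact Finset.card_erase_lt_of_mem hae

lemma exists_down (N : ℕ) : ∀ (S : Finset (Finset X)), ∑ f ∈ S, f.card ≤ N →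
    ∃ D : Finset (Finset X), IsDown D ∧ D.card = S.card ∧
      (∀ Y, (D.image (· ∩ Y)).card ≤ (S.image (· ∩ Y)).card) ∧ ∀ e ∈ D, ∃ f ∈ S, e ⊆ f := by
  induction N with
  | zero =>
    intro S hS
    refine ⟨S, ?_, rfl, fun _ => le_rfl, fun e he => ⟨e, he, le_rfl⟩⟩
    intro e he e' hee
    have : e.card = 0 := by
      have := Finset.sum_eq_zero_iff.1 (Nat.le_zero.1 hS) e he
      exact this
    have he0 : e = ∅ := Finset.card_eq_zero.1 this
    subst he0
    rw [Finset.subset_empty.1 hee]; exact he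
  | succ N ih =>
    intro S hS
    by_cases h : ∀ e ∈ S, ∀ a ∈ e, e.erase a ∈ S
    · refine ⟨S, ?_, rfl, fun _ => le_rfl, fun e he => ⟨e, he, le_rfl⟩⟩
      intro e
      induction e using Finset.strongInduction with
      | H e ihe =>
        intro he e' hee
        rcases eq_or_ne e' e with rfl | hne
        · exact he
        · obtain ⟨a, hae, hae'⟩ := Finset.exists_of_ssubset (hee.ssubset_of_ne hne)
          exact ihe (e.erase a) (Finset.erase_ssubset hae) (h e he a hae) e'
            (Finset.subset_erase.2 ⟨hee, hae'⟩)
    · push Not at h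
      obtain ⟨e, he, a, hae, hne⟩ := h
      obtain ⟨D, h1, h2, h3, h4⟩ := ih (Down.compression a S)
        (by have := sum_compression_lt a S e he hae hne; omega)
      refine ⟨D, h1, by rw [h2, Down.card_compression],
        fun Y => (h3 Y).trans (trace_compression_le a S Y), ?_⟩
      intro d hd
      obtain ⟨f, hf, hdf⟩ := h4 d hd
      rw [Down.mem_compression] at hf
      rcases hf with ⟨g1, _⟩ | ⟨_, g2⟩
      · exact ⟨f, g1, hdf⟩
      · exact ⟨_, g2, hdf.trans (Finset.subset_insert _ _)⟩

end

theorem real_shatter_bound {X : Type*} [DecidableEq X] [Fintype X]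
    (s : ℝ) (hs : 2 ≤ s)
    (t : ℕ) (ht : (t : ℤ) = ⌊Real.logb 2 s⌋)
    (m : ℕ) (hm : s ^ 3 ≤ (m : ℝ))
    (S : Finset (Finset X))
    (hS : (shatter S m : ℝ) <
      s * m - 10 * Real.sqrt m * s * Real.sqrt (Real.logb 2 s)) :
    ∀ n : ℕ, m ≤ n →
      (shatter S n : ℝ) ≤
        3 * (m : ℝ) ^ (2 * t) *
          (n : ℝ) ^ ((t : ℝ) + 1 - ((2 : ℝ) ^ (t + 1) - t - 2) / (s - 1)) := by
  intro n hmn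
  set L := Real.logb 2 s with hL
  have hs0 : 0 < s := by linarith
  have htL : (t : ℝ) ≤ L := by
    have := Int.floor_le L
    rw [← ht] at this; exact_mod_cast this
  have hLt : L < t + 1 := by
    have := Int.lt_floor_add_one L
    rw [← ht] at this; exact_mod_cast this
  have hts : (2 : ℝ) ^ t ≤ s := by
    have := (Real.le_logb_iff_rpow_le (by norm_num : (1 : ℝ) < 2) hs0).1 htL
    rwa [Real.rpow_natCast] at this
  have hst : s < 2 ^ (t + 1) := by
    have := (Real.logb_lt_iff_lt_rpow (by norm_num : (1 : ℝ) < 2) hs0).1 hLt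
    rw [← Nat.cast_add_one, Real.rpow_natCast] at this
    exact this
  have hL1 : 1 ≤ L := by
    rw [hL, Real.le_logb_iff_rpow_le (by norm_num) hs0]; simpa using hs
  have ht1 : 1 ≤ t := by
    by_contra h
    have : t = 0 := by omega
    subst this
    norm_num at hLt
    linarith
  have hm8 : (8 : ℝ) ≤ m := le_trans (by nlinarith [mul_self_nonneg s, pow_le_pow_left₀ (by norm_num : (0:ℝ) ≤ 2) hs 3]) hm
  have hm1 : 1 ≤ m := by
    have : (1 : ℝ) ≤ m := by linarith
    exact_mod_cast this
  have hsm : s ^ 2 ≤ m := by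
    have : s ^ 2 ≤ s ^ 3 := pow_le_pow_right₀ (by linarith) (by norm_num)
    linarith
  have hts2 : (t : ℝ) ≤ s := by
    have : (t : ℝ) < 2 ^ t := by exact_mod_cast Nat.lt_two_pow_self
    linarith
  set r := √(m : ℝ) with hr
  have hsr : s ≤ r := Real.le_sqrt_of_sq_le hsm
  have hr0 : 0 ≤ r := by linarith
  have hsL : 1 ≤ √L := Real.one_le_sqrt.2 hL1
  set w := (m : ℝ) - 10 * r * √L with hw
  have hSw : (shatter S m : ℝ) < s * w := by
    rw [hw]; linarith
  have hw0 : 0 ≤ w := by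
    have : (0 : ℝ) ≤ shatter S m := Nat.cast_nonneg _
    by_contra h
    push Not at h
    nlinarith
  have hn1 : (1 : ℝ) ≤ n := by exact_mod_cast hm1.trans hmn
  have hn0 : (0 : ℝ) < n := by linarith
  -- bound for each `Y`
  rw [← bet_eq t s hts]
  obtain ⟨b1, b2⟩ := bet_bounds t s hts
  have hΛ0 : (0 : ℝ) < 2 * m := by linarith
  have hconst : ((m : ℝ) + t) * (2 * m : ℝ) ^ ((t : ℝ) + 1 - bet t s) ≤ 3 * (m : ℝ) ^ (2 * t) := by
    have htm : (t : ℝ) ≤ m := by nlinarith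
    rcases eq_or_lt_of_le ht1 with h | h
    · subst h
      have he : ((1 : ℕ) : ℝ) + 1 - bet 1 s ≤ 1 := by
        simp only [bet]
        have := (theta_bounds hs).1
        push_cast
        linarith
      have h1 : (2 * m : ℝ) ^ (((1 : ℕ) : ℝ) + 1 - bet 1 s) ≤ 2 * m := by
        calc _ ≤ (2 * m : ℝ) ^ (1 : ℝ) := Real.rpow_le_rpow_of_exponent_le (by linarith) he
          _ = _ := Real.rpow_one _
      have h2 : ((m : ℝ) + (1 : ℕ)) * (2 * m : ℝ) ^ (((1 : ℕ) : ℝ) + 1 - bet 1 s)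
          ≤ (m + (1 : ℕ)) * (2 * m) := by gcongr
      refine h2.trans ?_
      push_cast
      nlinarith
    · have he : (t : ℝ) + 1 - bet t s ≤ 2 := by
        rw [bet_eq t s hts]
        have : ((2 : ℝ) ^ (t + 1) - t - 2) / (s - 1) ≤ 2 := by
          rw [div_le_iff₀ (by linarith), pow_succ]
          have : (0 : ℝ) ≤ t := Nat.cast_nonneg _
          linarith
        linarith
      have h1 : (2 * m : ℝ) ^ ((t : ℝ) + 1 - bet t s) ≤ (2 * m) ^ 2 := by
        calc _ ≤ (2 * m : ℝ) ^ (2 : ℝ) := Real.rpow_le_rpow_of_exponent_le (by linarith) he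
          _ = _ := by norm_num
      have h2 : ((m : ℝ) + t) * (2 * m : ℝ) ^ ((t : ℝ) + 1 - bet t s)
          ≤ (m + m) * (2 * m) ^ 2 := by gcongr
      have h3 : (m : ℝ) ^ 4 ≤ (m : ℝ) ^ (2 * t) := pow_le_pow_right₀ (by linarith) (by omega)
      have h4 : (8 : ℝ) * m ^ 3 ≤ m * m ^ 3 := mul_le_mul_of_nonneg_right hm8 (by positivity)
      have h5 : (0 : ℝ) ≤ m ^ 4 := by positivity
      nlinarith
  have hfin : ∀ Y ∈ (Finset.univ : Finset X).powersetCard n, ((S.image (· ∩ Y)).card : ℝ) ≤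
      3 * (m : ℝ) ^ (2 * t) * (n : ℝ) ^ bet t s := by
    intro Y hY
    have hYn := (Finset.mem_powersetCard.1 hY).2
    obtain ⟨D, d1, d2, d3, d4⟩ := exists_down _ (S.image (· ∩ Y)) le_rfl
    have hDV : ∀ e ∈ D, e ⊆ Y := by
      intro e he
      obtain ⟨f, hf, hef⟩ := d4 e he
      obtain ⟨g, _, rfl⟩ := Finset.mem_image.1 hf
      exact hef.trans Finset.inter_subset_right
    have hcnt : ∀ Z : Finset X, Z.card ≤ m → (cnt D Z : ℝ) < s * w := by
      intro Z hZ
      have hZ1 : (Z ∩ Y).card ≤ m := (Finset.card_le_card Finset.inter_subset_left).trans hZ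
      obtain ⟨Z', hZZ', hZ'Y, hZ'c⟩ := Finset.exists_subsuperset_card_eq
        (Finset.inter_subset_right : Z ∩ Y ⊆ Y) hZ1 (by omega)
      have h1 : cnt D Z ≤ (D.image (· ∩ Z')).card := by
        unfold cnt
        apply Finset.card_le_card
        intro e he
        obtain ⟨he1, he2⟩ := Finset.mem_filter.1 he
        refine Finset.mem_image.2 ⟨e, he1, ?_⟩
        exact Finset.inter_eq_left.2 ((Finset.subset_inter he2 (hDV e he1)).trans hZZ')
      have h2 : ((S.image (· ∩ Y)).image (· ∩ Z')).card ≤ shatter S m := by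
        have : (S.image (· ∩ Y)).image (· ∩ Z') = S.image (· ∩ Z') := by
          rw [Finset.image_image]
          apply Finset.image_congr
          intro e _
          simp only [Function.comp]
          rw [Finset.inter_assoc, Finset.inter_eq_right.2 hZ'Y]
        rw [this]
        unfold shatter
        exact Finset.le_sup (f := fun Y => (S.image (· ∩ Y)).card)
          (Finset.mem_powersetCard.2 ⟨Finset.subset_univ _, hZ'c⟩)
      have h3 : (cnt D Z : ℝ) ≤ shatter S m := by exact_mod_cast h1.trans ((d3 Z').trans h2)
      linarith
    have hmain := main_rec m w hw0 hm1 t s m D Y n hts hst hsm le_rfl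
      (by rw [hw]; nlinarith) d1 hDV hcnt hn1 (by exact_mod_cast hYn.le)
    rw [d2, ← mul_assoc] at hmain
    exact hmain.trans (mul_le_mul_of_nonneg_right hconst (by positivity))
  have h0 : (0 : ℝ) ≤ 3 * (m : ℝ) ^ (2 * t) * (n : ℝ) ^ bet t s := by positivity
  have hle : shatter S n ≤ ⌊3 * (m : ℝ) ^ (2 * t) * (n : ℝ) ^ bet t s⌋₊ := by
    unfold shatter
    apply Finset.sup_le
    intro Y hY
    exact Nat.le_floor (hfin Y hY)
  exact (Nat.le_floor_iff h0).1 hle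
end
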